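/- (Calegari) Fix a prime p and a level N with p ∤ N. For λ ≠ 0, the multiplicity m_p(λ,k,χ,N) of λ as an eigenvalue of T_p on S_{k,χ}(N) satisfies m_p(λ,k,χ,N) = O(v_p(λ)²), where the implied constant depends only on p and N and is independent of the weight k. -/

import Mathlib

/-!
Statement 19 (Calegari): fix a prime `p` and a level `N` with `p ∤ N`.  For `λ ≠ 0`, the
multiplicity `m_p(λ,k,χ,N)` of `λ` as an eigenvalue of `T_p` on `S_{k,χ}(N)` satisfies
`m_p(λ,k,χ,N) = O(v_p(λ)²)`, where the implied constant depends only on `p` and `N`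
(and not on the weight `k`); `v_p` is the `p`-adic valuation determined by a fixed
embedding `Q̄ ↪ Q̄_p`, normalised by `v_p(p) = 1`.

Cusp forms, the Hecke operator and eigenvalue multiplicities are modelled as in the
other files; the `p`-adic valuation on `ℂ` (coming from an abstract identification of
`ℂ` with `ℂ_p`) is axiomatised by the predicate `IsPadicValuation`.
-/

open Complex UpperHalfPlane ModularForm Manifold MatrixGroups

noncomputable section

/-- The point `x + i` of the upper half plane. -/
def pt (x : ℝ) : UpperHalfPlane := ⟨(x : ℂ) + Complex.I, by simp⟩

/-- `e(w) = exp(2πiw)`. -/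
def eexp (w : ℂ) : ℂ := Complex.exp (2 * Real.pi * Complex.I * w)

/-- The `n`-th Fourier coefficient `a_n(f)` of a `1`-periodic function on the upper half
plane. -/
def fCoeff (f : UpperHalfPlane → ℂ) (n : ℕ) : ℂ :=
  ∫ x in (0:ℝ)..1, f (pt x) * eexp (-(n : ℂ) * ((x : ℂ) + Complex.I))

/-- `f` is a holomorphic cusp form of weight `k`, level `Γ₀(N)` and nebentypus `χ`. -/
def IsCuspFormChi (N : ℕ) (k : ℤ) (χ : DirichletCharacter ℂ N) (f : UpperHalfPlane → ℂ) :
    Prop :=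
  MDifferentiable 𝓘(ℂ) 𝓘(ℂ) f ∧
  (∀ γ ∈ CongruenceSubgroup.Gamma0 N, ∀ z : UpperHalfPlane,
    f (γ • z) = (((γ.1 1 0 : ℤ) : ℂ) * (z : ℂ) + ((γ.1 1 1 : ℤ) : ℂ)) ^ k *
      χ ((γ.1 1 1 : ℤ) : ZMod N) * f z) ∧
  (∀ A : SL(2, ℤ), UpperHalfPlane.IsZeroAtImInfty (f ∣[k] A))

/-- The Hecke operator `T_p` at a prime `p ∤ N`, via the Fourier expansion at `∞`. -/
def heckeT (N p : ℕ) (k : ℤ) (χ : DirichletCharacter ℂ N) (f : UpperHalfPlane → ℂ) :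
    UpperHalfPlane → ℂ := fun z =>
  (∑' n : ℕ, fCoeff f ((n + 1) * p) * eexp (((n : ℂ) + 1) * (z : ℂ))) +
    (p : ℂ) ^ (k - 1) * χ (p : ZMod N) *
      ∑' n : ℕ, fCoeff f (n + 1) * eexp ((p : ℂ) * ((n : ℂ) + 1) * (z : ℂ))

/-- `m_p(λ,k,χ,N)`: the multiplicity of `λ` as an eigenvalue of `T_p` on `S_{k,χ}(N)`. -/
def heckeMult (N p : ℕ) (k : ℤ) (χ : DirichletCharacter ℂ N) (lam : ℂ) : ℕ :=
  Module.finrank ℂ (Submodule.span ℂ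
    {f : UpperHalfPlane → ℂ | IsCuspFormChi N k χ f ∧ heckeT N p k χ f = fun z => lam * f z})

/-- `v : ℂ → ℝ` behaves, on nonzero elements, like the `p`-adic valuation obtained from an
abstract identification of `ℂ` with `ℂ_p` (equivalently, from a fixed embedding
`Q̄ ↪ Q̄_p` on algebraic numbers), normalised so that `v(p) = 1`. -/
structure IsPadicValuation (p : ℕ) (v : ℂ → ℝ) : Prop where
  map_mul : ∀ x y : ℂ, x ≠ 0 → y ≠ 0 → v (x * y) = v x + v y
  map_p : v (p : ℂ) = 1
  map_one : v 1 = 0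
  nonarch : ∀ x y : ℂ, x ≠ 0 → y ≠ 0 → x + y ≠ 0 → min (v x) (v y) ≤ v (x + y)


/-! ### Primitives on the upper half plane -/

open Filter Topology Asymptotics

/-- A holomorphic function on the upper half plane has a primitive. -/
lemma exists_prim_uhp (h : ℂ → ℂ) (hh : DifferentiableOn ℂ h {z | 0 < z.im}) :
    ∃ G : ℂ → ℂ, ∀ z : ℂ, 0 < z.im → HasDerivAt G (h z) z := by
  set φ : ℂ → ℂ := fun w => Complex.I * (1 + w) / (1 - w) with hφ
  set ψ : ℂ → ℂ := fun z => (z - Complex.I) / (z + Complex.I) with hψ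
  have hne : ∀ w ∈ Metric.ball (0:ℂ) 1, (1 - w) ≠ 0 := by
    intro w hw h0
    have : w = 1 := by linear_combination -h0
    subst this
    simp at hw
  have hφim : ∀ w ∈ Metric.ball (0:ℂ) 1, 0 < (φ w).im := by
    intro w hw
    have h1 : Complex.normSq w < 1 := by
      rw [Complex.normSq_eq_norm_sq]
      have := mem_ball_zero_iff.mp hw
      have h0 := norm_nonneg w
      nlinarith
    have hn := Complex.normSq_pos.mpr (hne w hw)
    have : (φ w).im = (1 - Complex.normSq w) / Complex.normSq (1 - w) := by
      simp only [hφ, Complex.div_im, Complex.normSq_apply, Complex.mul_im, Complex.mul_re,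
        Complex.I_re, Complex.I_im, Complex.add_re, Complex.add_im, Complex.sub_re, Complex.sub_im,
        Complex.one_re, Complex.one_im]
      field_simp
      ring
    rw [this]
    exact div_pos (by linarith) hn
  have hdφ : ∀ w ∈ Metric.ball (0:ℂ) 1, HasDerivAt φ (2 * Complex.I / (1 - w) ^ 2) w := by
    intro w hw
    have h1 : HasDerivAt (fun w : ℂ => Complex.I * (1 + w)) (Complex.I * 1) w :=
      ((hasDerivAt_id w).const_add 1).const_mul _
    have h2 : HasDerivAt (fun w : ℂ => 1 - w) (-1) w := by
      simpa using (hasDerivAt_id w).const_sub 1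
    refine (h1.fun_div h2 (hne w hw)).congr_deriv ?_
    ring
  have hdiff : DifferentiableOn ℂ (fun w => h (φ w) * (2 * Complex.I / (1 - w) ^ 2))
      (Metric.ball 0 1) := by
    apply DifferentiableOn.mul
    · apply hh.comp
      · intro w hw
        exact (hdφ w hw).differentiableAt.differentiableWithinAt
      · intro w hw
        exact hφim w hw
    · intro w hw
      apply DifferentiableAt.differentiableWithinAt
      have := hne w hw
      fun_prop (disch := positivity)
  obtain ⟨G, hG⟩ := hdiff.isExactOn_ball
  refine ⟨fun z => G (ψ z), fun z hz => ?_⟩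
  have hzI : z + Complex.I ≠ 0 := by
    intro h0
    have := congrArg Complex.im h0
    simp at this
    linarith
  have hψm : ψ z ∈ Metric.ball (0:ℂ) 1 := by
    rw [mem_ball_zero_iff]
    simp only [hψ, norm_div]
    rw [div_lt_one (norm_pos_iff.mpr hzI)]
    rw [← abs_of_nonneg (norm_nonneg (z - Complex.I)), ← abs_of_nonneg (norm_nonneg (z + Complex.I)),
      ← sq_lt_sq, ← Complex.normSq_eq_norm_sq, ← Complex.normSq_eq_norm_sq]
    simp only [Complex.normSq_apply, Complex.add_re, Complex.sub_re, Complex.add_im, Complex.sub_im,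
      Complex.I_re, Complex.I_im]
    nlinarith
  have hφψ : φ (ψ z) = z := by
    have h1 : 1 - ψ z = 2 * Complex.I / (z + Complex.I) := by
      simp only [hψ]; field_simp; ring
    have h2 : 1 + ψ z = 2 * z / (z + Complex.I) := by
      simp only [hψ]; field_simp; ring
    simp only [hφ, h1, h2]
    field_simp
  have hdψ : HasDerivAt ψ (2 * Complex.I / (z + Complex.I) ^ 2) z := by
    have h1 : HasDerivAt (fun z : ℂ => z - Complex.I) 1 z := (hasDerivAt_id z).sub_const _
    have h2 : HasDerivAt (fun z : ℂ => z + Complex.I) 1 z := (hasDerivAt_id z).add_const _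
    refine (h1.fun_div h2 hzI).congr_deriv ?_
    ring
  have := (hG _ hψm).comp z hdψ
  refine this.congr_deriv ?_
  simp only [hφψ]
  have h1 : 1 - ψ z = 2 * Complex.I / (z + Complex.I) := by
    simp only [hψ]; field_simp; ring
  rw [h1]
  have hI : Complex.I ≠ 0 := Complex.I_ne_zero
  field_simp

/-- Two primitives on the upper half plane differ by a constant. -/
lemma prim_unique {G H g : ℂ → ℂ} (hG : ∀ z : ℂ, 0 < z.im → HasDerivAt G (g z) z)
    (hH : ∀ z : ℂ, 0 < z.im → HasDerivAt H (g z) z) :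
    ∃ c : ℂ, ∀ z : ℂ, 0 < z.im → G z = H z + c := by
  have hd : ∀ z : ℂ, 0 < z.im → HasDerivAt (fun z => G z - H z) 0 z := by
    intro z hz
    exact ((hG z hz).fun_sub (hH z hz)).congr_deriv (sub_self _)
  refine ⟨G Complex.I - H Complex.I, fun z hz => ?_⟩
  have hconv : Convex ℝ {z : ℂ | 0 < z.im} := convex_halfSpace_im_gt 0
  have hopen : IsOpen {z : ℂ | 0 < z.im} := isOpen_lt continuous_const Complex.continuous_im
  have := IsOpen.is_const_of_deriv_eq_zero hopen hconv.isPreconnected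
    (f := fun z => G z - H z) (fun z hz => (hd z hz).differentiableAt.differentiableWithinAt)
    (fun z hz => (hd z hz).deriv) (x := z) (y := Complex.I) hz (by simp)
  linear_combination this

/-! ### Rapid decay in vertical strips -/

/-- `z → i∞` within the strip `|Re z| ≤ R`. -/
def lf (R : ℝ) : Filter ℂ := comap Complex.im atTop ⊓ 𝓟 {z | |z.re| ≤ R}

/-- Rapid decay in vertical strips. -/
def RD (φ : ℂ → ℂ) : Prop := ∀ (R : ℝ) (s : ℕ), φ =O[lf R] fun z => (z.im ^ s)⁻¹

lemma eventually_lf {R : ℝ} {P : ℂ → Prop} :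
    (∀ᶠ z in lf R, P z) ↔ ∃ Y : ℝ, 1 ≤ Y ∧ ∀ z : ℂ, Y ≤ z.im → |z.re| ≤ R → P z := by
  rw [lf, eventually_inf_principal, eventually_comap, eventually_atTop]
  constructor
  · rintro ⟨a, ha⟩
    exact ⟨max a 1, le_max_right _ _, fun z hz hR => ha z.im (le_trans (le_max_left _ _) hz) z rfl hR⟩
  · rintro ⟨Y, _, hY⟩
    exact ⟨Y, fun b hb z hz hR => hY z (hz ▸ hb) hR⟩

lemma RD_iff {φ : ℂ → ℂ} : RD φ ↔ ∀ (R : ℝ) (s : ℕ), ∃ C Y : ℝ, 0 ≤ C ∧ 1 ≤ Y ∧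
    ∀ z : ℂ, Y ≤ z.im → |z.re| ≤ R → ‖φ z‖ ≤ C * (z.im ^ s)⁻¹ := by
  constructor
  · intro h R s
    obtain ⟨C, hC, hb⟩ := (h R s).exists_nonneg
    obtain ⟨Y, hY1, hY⟩ := eventually_lf.mp hb.bound
    refine ⟨C, Y, hC, hY1, fun z hz hR => ?_⟩
    have := hY z hz hR
    rwa [Real.norm_of_nonneg (by have : 0 < z.im := by linarith
                                 positivity)] at this
  · intro h R s
    obtain ⟨C, Y, _, hY1, hY⟩ := h R s
    refine IsBigO.of_bound C (eventually_lf.mpr ⟨Y, hY1, fun z hz hR => ?_⟩)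
    rw [Real.norm_of_nonneg (by have : 0 < z.im := by linarith
                                positivity)]
    exact hY z hz hR

lemma RD.add {φ ψ : ℂ → ℂ} (h : RD φ) (h' : RD ψ) : RD (fun z => φ z + ψ z) :=
  fun R s => (h R s).add (h' R s)

lemma RD.sum {ι : Type*} (t : Finset ι) {φ : ι → ℂ → ℂ} (h : ∀ i ∈ t, RD (φ i)) :
    RD (fun z => ∑ i ∈ t, φ i z) :=
  fun R s => IsBigO.fun_sum (fun i hi => h i hi R s)

lemma RD.const_mul {φ : ℂ → ℂ} (c : ℂ) (h : RD φ) : RD (fun z => c * φ z) :=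
  fun R s => (h R s).const_mul_left c

lemma RD.congr {φ ψ : ℂ → ℂ} (h : RD φ) (he : ∀ z : ℂ, 0 < z.im → φ z = ψ z) : RD ψ := by
  intro R s
  refine (h R s).congr' (eventually_lf.mpr ⟨1, le_rfl, fun z hz _ => he z (by linarith)⟩)
    EventuallyEq.rfl

lemma RD.affine_mul {φ : ℂ → ℂ} (a b : ℂ) (h : RD φ) : RD (fun z => (a * z + b) * φ z) := by
  rw [RD_iff] at *
  intro R s
  obtain ⟨C, Y, hC, hY1, hY⟩ := h R (s + 1)
  refine ⟨(‖a‖ * (|R| + 1) + ‖b‖) * C, Y, by positivity, hY1, fun z hz hR => ?_⟩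
  have hz0 : 1 ≤ z.im := by linarith
  have h1 := hY z hz hR
  have h2 : ‖z‖ ≤ (|R| + 1) * z.im := by
    calc ‖z‖ ≤ |z.re| + |z.im| := Complex.norm_le_abs_re_add_abs_im z
      _ ≤ |R| + z.im := by
        rw [abs_of_pos (show 0 < z.im by linarith)]
        linarith [le_abs_self R]
      _ ≤ _ := by nlinarith [abs_nonneg R]
  have h3 : ‖a * z + b‖ ≤ (‖a‖ * (|R| + 1) + ‖b‖) * z.im := by
    calc ‖a * z + b‖ ≤ ‖a‖ * ‖z‖ + ‖b‖ := by
          refine (norm_add_le _ _).trans ?_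
          rw [norm_mul]
      _ ≤ ‖a‖ * ((|R| + 1) * z.im) + ‖b‖ * z.im := by
          gcongr
          nlinarith [norm_nonneg b]
      _ = _ := by ring
  rw [norm_mul]
  calc ‖a * z + b‖ * ‖φ z‖ ≤ ((‖a‖ * (|R| + 1) + ‖b‖) * z.im) * (C * (z.im ^ (s+1))⁻¹) := by
        gcongr
    _ = _ := by
        have : z.im ≠ 0 := by linarith
        rw [pow_succ]
        field_simp

lemma RD.affine_pow_mul {φ : ℂ → ℂ} (a b : ℂ) (n : ℕ) (h : RD φ) :
    RD (fun z => (a * z + b) ^ n * φ z) := by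
  induction n with
  | zero => simpa using h
  | succ n ih =>
    refine (ih.affine_mul a b).congr (fun z _ => ?_)
    ring

lemma vert_bound {Φ Φ' : ℂ → ℂ} (hΦ : ∀ z : ℂ, 0 < z.im → HasDerivAt Φ (Φ' z) z)
    {C Y x : ℝ} {s : ℕ} (hC : 0 ≤ C) (hY : 1 ≤ Y)
    (hb : ∀ y : ℝ, Y ≤ y → ‖Φ' (x + y * Complex.I)‖ ≤ C * (y ^ (s + 2))⁻¹)
    {y y' : ℝ} (hy : Y ≤ y) (hyy : y ≤ y') :
    ‖Φ (x + y' * Complex.I) - Φ (x + y * Complex.I)‖ ≤ C * (y ^ (s + 1))⁻¹ := by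
  have hy0 : 0 < y := by linarith
  have hy0' : 0 < y' := by linarith
  set S : Set ℝ := Set.Ioc 0 y⁻¹
  have key := Convex.norm_image_sub_le_of_norm_hasDerivWithin_le (𝕜 := ℝ)
    (f := fun t : ℝ => Φ (x + (t⁻¹ : ℝ) * Complex.I))
    (f' := fun t : ℝ => Φ' (x + (t⁻¹ : ℝ) * Complex.I) * ((-(t^2)⁻¹ : ℝ) * Complex.I))
    (s := S) (x := y⁻¹) (y := y'⁻¹) (C := C * (y ^ s)⁻¹) ?_ ?_ (convex_Ioc _ _) ?_ ?_
  · simp only [inv_inv] at key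
    refine key.trans ?_
    have : ‖y'⁻¹ - y⁻¹‖ ≤ y⁻¹ := by
      have h1 : y'⁻¹ ≤ y⁻¹ := by gcongr
      have h2 : 0 < y'⁻¹ := by positivity
      rw [Real.norm_eq_abs, abs_le]
      constructor <;> linarith
    calc C * (y ^ s)⁻¹ * ‖y'⁻¹ - y⁻¹‖ ≤ C * (y ^ s)⁻¹ * y⁻¹ := by gcongr
      _ = _ := by rw [pow_succ, mul_inv, mul_assoc]
  · intro t ht
    have ht0 : 0 < t := ht.1
    apply HasDerivAt.hasDerivWithinAt
    have h1 : HasDerivAt (fun t : ℝ => ((x : ℂ) + (t⁻¹ : ℝ) * Complex.I))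
        ((-(t^2)⁻¹ : ℝ) * Complex.I) t := by
      have := (hasDerivAt_inv ht0.ne').ofReal_comp
      exact (this.mul_const Complex.I).const_add _
    have h2 := hΦ (x + (t⁻¹ : ℝ) * Complex.I) (by simp [ht0])
    exact h2.comp t h1
  · intro t ht
    have ht0 : 0 < t := ht.1
    have hty : y ≤ t⁻¹ := by
      rw [le_inv_comm₀ hy0 ht0]; exact ht.2
    have := hb t⁻¹ (by linarith)
    rw [norm_mul, norm_mul, Complex.norm_I, mul_one, Complex.norm_real, norm_neg,
      Real.norm_of_nonneg (by positivity)]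
    calc ‖Φ' (x + (t⁻¹ : ℝ) * Complex.I)‖ * (t ^ 2)⁻¹
        ≤ C * ((t⁻¹) ^ (s + 2))⁻¹ * (t ^ 2)⁻¹ := by gcongr
      _ = C * ((t⁻¹) ^ s)⁻¹ := by
          rw [pow_add, inv_pow, inv_pow, mul_inv, inv_inv, inv_inv]
          field_simp
      _ ≤ C * (y ^ s)⁻¹ := by gcongr
  · exact ⟨by positivity, le_rfl⟩
  · exact ⟨by positivity, by gcongr⟩

lemma RD.exists_limit {Φ Φ' : ℂ → ℂ} (hΦ : ∀ z : ℂ, 0 < z.im → HasDerivAt Φ (Φ' z) z)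
    (h : RD Φ') : ∃ l : ℂ, RD (fun z => Φ z - l) := by
  rw [RD_iff] at h
  -- existence of the limit along the imaginary axis
  obtain ⟨l, hl⟩ : ∃ l : ℂ, Tendsto (fun y : ℝ => Φ ((0:ℝ) + y * Complex.I)) atTop (𝓝 l) := by
    obtain ⟨C, Y, hC, hY1, hb⟩ := h 0 2
    have hb' : ∀ y : ℝ, Y ≤ y → ‖Φ' ((0:ℝ) + y * Complex.I)‖ ≤ C * (y ^ (0 + 2))⁻¹ := by
      intro y hy
      have := hb ((0:ℝ) + y * Complex.I) (by simpa using hy) (by simp)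
      simpa using this
    have hc : CauchySeq (fun t : ℝ => Φ ((0:ℝ) + (max t Y : ℝ) * Complex.I)) := by
      refine cauchySeq_of_le_tendsto_0' (fun t : ℝ => C * ((max t Y) ^ (0 + 1))⁻¹) ?_ ?_
      · intro n m hnm
        rw [dist_comm, dist_eq_norm]
        exact vert_bound hΦ hC hY1 hb' (le_max_right _ _) (max_le_max_right _ hnm)
      · have h1 : Tendsto (fun t : ℝ => max t Y) atTop atTop :=
          tendsto_atTop_mono (fun t => le_max_left t Y) tendsto_id
        simpa using (h1.inv_tendsto_atTop).const_mul C
    obtain ⟨l, hl⟩ := cauchySeq_tendsto_of_complete hc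
    refine ⟨l, hl.congr' ?_⟩
    filter_upwards [eventually_ge_atTop Y] with t ht
    rw [max_eq_left ht]
  refine ⟨l, RD_iff.mpr fun R s => ?_⟩
  obtain ⟨C, Y, hC, hY1, hb⟩ := h |R| (s + 2)
  refine ⟨C + C * |R|, Y, by positivity, hY1, fun z hz hR => ?_⟩
  have hz1 : 1 ≤ z.im := by linarith
  have hb' : ∀ y : ℝ, Y ≤ y → ‖Φ' ((0:ℝ) + y * Complex.I)‖ ≤ C * (y ^ (s + 2))⁻¹ := by
    intro y hy
    have := hb ((0:ℝ) + y * Complex.I) (by simpa using hy) (by simp)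
    simpa using this
  have h1 : ‖l - Φ ((0:ℝ) + z.im * Complex.I)‖ ≤ C * (z.im ^ (s + 1))⁻¹ := by
    refine le_of_tendsto ((hl.sub_const _).norm) ?_
    filter_upwards [eventually_ge_atTop z.im] with t ht
    exact vert_bound hΦ hC hY1 hb' hz ht
  have h2 : ‖Φ z - Φ ((0:ℝ) + z.im * Complex.I)‖ ≤
      C * (z.im ^ (s + 2))⁻¹ * ‖z - ((0:ℝ) + z.im * Complex.I)‖ := by
    refine Convex.norm_image_sub_le_of_norm_hasDerivWithin_le (𝕜 := ℂ) (f' := Φ')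
      (s := segment ℝ ((0:ℝ) + z.im * Complex.I : ℂ) z) ?_ ?_ (convex_segment _ _)
      (left_mem_segment _ _ _) (right_mem_segment _ _ _)
    all_goals
      rintro w ⟨a, b, ha, hb0, hab, rfl⟩
      have him : (a • ((0:ℝ) + z.im * Complex.I : ℂ) + b • z).im = z.im := by
        simp
        rw [← add_mul, hab, one_mul]
    · exact (hΦ _ (by rw [him]; linarith)).hasDerivWithinAt
    · refine (hb _ (by rw [him]; exact hz) ?_).trans (by rw [him])
      simp [abs_mul, abs_of_nonneg hb0]
      have h1 : b ≤ 1 := by linarith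
      have h2 : |z.re| ≤ |R| := hR.trans (le_abs_self R)
      nlinarith [abs_nonneg z.re]
  have h3 : ‖z - ((0:ℝ) + z.im * Complex.I)‖ ≤ |R| := by
    have : z - ((0:ℝ) + z.im * Complex.I) = (z.re : ℂ) := by
      apply Complex.ext <;> simp
    rw [this, Complex.norm_real, Real.norm_eq_abs]
    exact hR.trans (le_abs_self R)
  have e1 : (z.im ^ (s + 1))⁻¹ ≤ (z.im ^ s)⁻¹ := by
    gcongr 1
    exact pow_le_pow_right₀ hz1 (by omega)
  have e2 : (z.im ^ (s + 2))⁻¹ ≤ (z.im ^ s)⁻¹ := by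
    gcongr 1
    exact pow_le_pow_right₀ hz1 (by omega)
  calc ‖Φ z - l‖ = ‖(Φ z - Φ ((0:ℝ) + z.im * Complex.I)) -
        (l - Φ ((0:ℝ) + z.im * Complex.I))‖ := by congr 1; ring
    _ ≤ C * (z.im ^ (s + 2))⁻¹ * |R| + C * (z.im ^ (s + 1))⁻¹ := by
        refine (norm_sub_le _ _).trans (add_le_add (h2.trans ?_) h1)
        gcongr
    _ ≤ C * (z.im ^ s)⁻¹ * |R| + C * (z.im ^ s)⁻¹ := by gcongr
    _ = _ := by ring

lemma RD.tendsto {φ : ℂ → ℂ} (h : RD φ) {z : ℝ → ℂ} {R : ℝ}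
    (h1 : Tendsto (fun y => (z y).im) atTop atTop) (h2 : ∀ y, |(z y).re| ≤ R) :
    Tendsto (fun y => φ (z y)) atTop (𝓝 0) := by
  have h3 : Tendsto z atTop (lf R) := by
    rw [lf, tendsto_inf]
    exact ⟨tendsto_comap_iff.mpr h1, tendsto_principal.mpr (Eventually.of_forall h2)⟩
  refine ((h R 1).comp_tendsto h3).trans_tendsto ?_
  simpa [Function.comp_def, Pi.inv_def] using h1.inv_tendsto_atTop

/-! ### Möbius maps, primitives and limits at cusps -/

/-- The Möbius map of an integral matrix, as a function on `ℂ`. -/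
def mob (A : SL(2, ℤ)) (z : ℂ) : ℂ :=
  (((A.1 0 0 : ℤ) : ℂ) * z + ((A.1 0 1 : ℤ) : ℂ)) / (((A.1 1 0 : ℤ) : ℂ) * z + ((A.1 1 1 : ℤ) : ℂ))

/-- The denominator `cz+d`. -/
def den (A : SL(2, ℤ)) (z : ℂ) : ℂ := ((A.1 1 0 : ℤ) : ℂ) * z + ((A.1 1 1 : ℤ) : ℂ)

/-- The numerator `az+b`. -/
def nmr (A : SL(2, ℤ)) (z : ℂ) : ℂ := ((A.1 0 0 : ℤ) : ℂ) * z + ((A.1 0 1 : ℤ) : ℂ)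

lemma mob_eq (A : SL(2, ℤ)) (z : ℂ) : mob A z = nmr A z / den A z := rfl

lemma coe_smul_eq_mob (A : SL(2, ℤ)) (z : UpperHalfPlane) :
    ((A • z : UpperHalfPlane) : ℂ) = mob A z := by
  rw [UpperHalfPlane.coe_specialLinearGroup_apply]
  simp [mob]

lemma det_eq (A : SL(2, ℤ)) : ((A.1 0 0 : ℤ) : ℂ) * ((A.1 1 1 : ℤ) : ℂ) -
    ((A.1 0 1 : ℤ) : ℂ) * ((A.1 1 0 : ℤ) : ℂ) = 1 := by
  have := A.2
  rw [Matrix.det_fin_two] at this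
  exact_mod_cast this

lemma denom_eq_den (A : SL(2, ℤ)) (z : ℂ) :
    UpperHalfPlane.denom ((A : SL(2, ℤ)) : GL (Fin 2) ℝ) z = den A z := by
  simp [UpperHalfPlane.denom, den]

lemma den_ne_zero (A : SL(2, ℤ)) {z : ℂ} (hz : 0 < z.im) : den A z ≠ 0 := by
  rw [← denom_eq_den]
  exact UpperHalfPlane.denom_ne_zero_of_im _ hz.ne'

lemma mob_ofComplex (A : SL(2, ℤ)) {z : ℂ} (hz : 0 < z.im) :
    mob A z = ((A • UpperHalfPlane.ofComplex z : UpperHalfPlane) : ℂ) := by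
  rw [coe_smul_eq_mob, UpperHalfPlane.ofComplex_apply_of_im_pos hz]

lemma mob_im_pos (A : SL(2, ℤ)) {z : ℂ} (hz : 0 < z.im) : 0 < (mob A z).im := by
  rw [mob_ofComplex A hz]
  exact UpperHalfPlane.im_pos _

lemma ofComplex_mob (A : SL(2, ℤ)) {z : ℂ} (hz : 0 < z.im) :
    UpperHalfPlane.ofComplex (mob A z) = A • UpperHalfPlane.ofComplex z := by
  rw [mob_ofComplex A hz, UpperHalfPlane.ofComplex_apply]

lemma mob_mul (A B : SL(2, ℤ)) {z : ℂ} (hz : 0 < z.im) : mob (A * B) z = mob A (mob B z) := by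
  rw [mob_ofComplex _ hz, mul_smul, coe_smul_eq_mob, ← mob_ofComplex B hz]

lemma hasDerivAt_mob (A : SL(2, ℤ)) {z : ℂ} (hz : 0 < z.im) :
    HasDerivAt (mob A) ((den A z ^ 2)⁻¹) z := by
  have h1 : HasDerivAt (nmr A) ((A.1 0 0 : ℤ) : ℂ) z := by
    unfold nmr
    simpa using ((hasDerivAt_id z).const_mul ((A.1 0 0 : ℤ) : ℂ)).add_const ((A.1 0 1 : ℤ) : ℂ)
  have h2 : HasDerivAt (den A) ((A.1 1 0 : ℤ) : ℂ) z := by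
    unfold den
    simpa using ((hasDerivAt_id z).const_mul ((A.1 1 0 : ℤ) : ℂ)).add_const ((A.1 1 1 : ℤ) : ℂ)
  refine (h1.fun_div h2 (den_ne_zero A hz)).congr_deriv ?_
  rw [inv_eq_one_div]
  congr 1
  have := det_eq A
  simp only [nmr, den]
  linear_combination this

/-- `F` is a primitive of `f(z) z^i` on the upper half plane. -/
def IsPrim (f : UpperHalfPlane → ℂ) (i : ℕ) (F : ℂ → ℂ) : Prop :=
  ∀ z : ℂ, 0 < z.im → HasDerivAt F (f (UpperHalfPlane.ofComplex z) * z ^ i) z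

lemma slash_ofComplex (f : UpperHalfPlane → ℂ) (A : SL(2, ℤ)) (k : ℤ) {z : ℂ} (hz : 0 < z.im) :
    (f ∣[k] A) (UpperHalfPlane.ofComplex z) =
      f (UpperHalfPlane.ofComplex (mob A z)) * den A z ^ (-k) := by
  rw [ModularForm.SL_slash_apply, ofComplex_mob A hz, denom_eq_den,
    UpperHalfPlane.ofComplex_apply_of_im_pos hz]

lemma IsPrim.comp_mob {f : UpperHalfPlane → ℂ} {i m : ℕ} {F : ℂ → ℂ} (hF : IsPrim f i F)
    (him : i ≤ m) (A : SL(2, ℤ)) {z : ℂ} (hz : 0 < z.im) :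
    HasDerivAt (fun z => F (mob A z))
      ((f ∣[(m + 2 : ℤ)] A) (UpperHalfPlane.ofComplex z) * (nmr A z ^ i * den A z ^ (m - i))) z := by
  refine ((hF _ (mob_im_pos A hz)).comp z (hasDerivAt_mob A hz)).congr_deriv ?_
  rw [slash_ofComplex f A _ hz, mob_eq]
  have hd := den_ne_zero A hz
  have : den A z ^ (-(m + 2 : ℤ)) = (den A z ^ i * den A z ^ (m - i) * den A z ^ 2)⁻¹ := by
    rw [zpow_neg, ← pow_add, ← pow_add, Nat.add_sub_cancel' him]
    norm_cast
  rw [this, div_pow]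
  field_simp

lemma exists_isPrim {f : UpperHalfPlane → ℂ} (hf : MDifferentiable 𝓘(ℂ) 𝓘(ℂ) f) (i : ℕ) :
    ∃ F : ℂ → ℂ, IsPrim f i F := by
  rw [UpperHalfPlane.mdifferentiable_iff] at hf
  exact exists_prim_uhp (fun z => f (UpperHalfPlane.ofComplex z) * z ^ i)
    (hf.mul (differentiable_id.pow i).differentiableOn)

open Classical in
/-- A chosen primitive of `f(z) z^i`, vanishing at `I`. -/
def prim (f : UpperHalfPlane → ℂ) (i : ℕ) : ℂ → ℂ :=
  if h : ∃ F : ℂ → ℂ, IsPrim f i F then fun z => h.choose z - h.choose Complex.I else 0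

lemma prim_isPrim {f : UpperHalfPlane → ℂ} (hf : MDifferentiable 𝓘(ℂ) 𝓘(ℂ) f) (i : ℕ) :
    IsPrim f i (prim f i) := by
  have h := exists_isPrim hf i
  intro z hz
  rw [prim, dif_pos h]
  exact (h.choose_spec z hz).sub_const _

lemma prim_I (f : UpperHalfPlane → ℂ) (i : ℕ) : prim f i Complex.I = 0 := by
  rw [prim]
  split_ifs <;> simp

lemma prim_eq_of {f : UpperHalfPlane → ℂ} (hf : MDifferentiable 𝓘(ℂ) 𝓘(ℂ) f) (i : ℕ)
    {G : ℂ → ℂ} (hG : IsPrim f i G) (hI : G Complex.I = 0) {z : ℂ} (hz : 0 < z.im) :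
    prim f i z = G z := by
  obtain ⟨c, hc⟩ := prim_unique (prim_isPrim hf i) hG
  have := hc Complex.I (by simp)
  rw [prim_I, hI] at this
  rw [hc z hz]
  linear_combination -this

lemma prim_add {f g : UpperHalfPlane → ℂ} (hf : MDifferentiable 𝓘(ℂ) 𝓘(ℂ) f)
    (hg : MDifferentiable 𝓘(ℂ) 𝓘(ℂ) g) (i : ℕ) {z : ℂ} (hz : 0 < z.im) :
    prim (f + g) i z = prim f i z + prim g i z := by
  refine prim_eq_of (hf.add hg) i (G := fun z => prim f i z + prim g i z) ?_ (by simp [prim_I]) hz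
  intro w hw
  refine ((prim_isPrim hf i w hw).fun_add (prim_isPrim hg i w hw)).congr_deriv ?_
  simp only [Pi.add_apply]
  ring

lemma prim_smul {f : UpperHalfPlane → ℂ} (hf : MDifferentiable 𝓘(ℂ) 𝓘(ℂ) f) (c : ℂ)
    (i : ℕ) {z : ℂ} (hz : 0 < z.im) :
    prim (c • f) i z = c * prim f i z := by
  refine prim_eq_of (hf.const_smul c) i (G := fun z => c * prim f i z) ?_ (by simp [prim_I]) hz
  intro w hw
  refine ((prim_isPrim hf i w hw).const_mul c).congr_deriv ?_
  simp only [Pi.smul_apply, smul_eq_mul]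
  ring

/-! ### Decay of cusp forms -/

section decay

lemma slash_Gamma_periodic {N : ℕ} {k : ℤ} {f : UpperHalfPlane → ℂ}
    (hinv : ∀ γ ∈ CongruenceSubgroup.Gamma N, f ∣[k] γ = f) (A : SL(2, ℤ)) :
    Function.Periodic ((f ∣[k] A) ∘ UpperHalfPlane.ofComplex) (N : ℝ) := by
  have hTN : (ModularGroup.T ^ (N : ℤ)).1 = !![1, (N : ℤ); 0, 1] := ModularGroup.coe_T_zpow N
  have hT : ModularGroup.T ^ (N : ℤ) ∈ CongruenceSubgroup.Gamma N := by
    rw [CongruenceSubgroup.Gamma_mem]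
    simp only [hTN]
    simp
  have hmem : A * ModularGroup.T ^ (N : ℤ) * A⁻¹ ∈ CongruenceSubgroup.Gamma N :=
    (CongruenceSubgroup.Gamma_normal N).conj_mem _ hT A
  have hinv' : (f ∣[k] A) ∣[k] (ModularGroup.T ^ (N : ℤ)) = f ∣[k] A := by
    rw [← SlashAction.slash_mul]
    have : A * ModularGroup.T ^ (N : ℤ) = (A * ModularGroup.T ^ (N : ℤ) * A⁻¹) * A := by group
    rw [this, SlashAction.slash_mul, hinv _ hmem]
  intro z
  by_cases hz : 0 < z.im
  · have := congrFun hinv' (UpperHalfPlane.ofComplex z)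
    rw [slash_ofComplex _ _ _ hz] at this
    have hd : den (ModularGroup.T ^ (N : ℤ)) z = 1 := by
      simp only [den, hTN]
      simp
    have hm : mob (ModularGroup.T ^ (N : ℤ)) z = z + (N : ℝ) := by
      simp only [mob, hTN]
      simp
    rw [hd, hm, one_zpow, mul_one] at this
    exact this
  · have h1 : z.im ≤ 0 := not_lt.mp hz
    have h2 : (z + ((N : ℝ) : ℂ)).im ≤ 0 := by simpa using h1
    simp only [Function.comp_apply]
    rw [UpperHalfPlane.ofComplex_apply_of_im_nonpos h1,
      UpperHalfPlane.ofComplex_apply_of_im_nonpos h2]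

lemma RD_of_cusp {N : ℕ} (hN : 0 < N) {k : ℤ} {f : UpperHalfPlane → ℂ}
    (hf : MDifferentiable 𝓘(ℂ) 𝓘(ℂ) f)
    (hinv : ∀ γ ∈ CongruenceSubgroup.Gamma N, f ∣[k] γ = f) (A : SL(2, ℤ))
    (hz : UpperHalfPlane.IsZeroAtImInfty (f ∣[k] A)) :
    RD (fun z => (f ∣[k] A) (UpperHalfPlane.ofComplex z)) := by
  have hN' : (0:ℝ) < N := by exact_mod_cast hN
  have hdiff : MDifferentiable 𝓘(ℂ) 𝓘(ℂ) (f ∣[k] A) := by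
    rw [ModularForm.SL_slash]
    exact _root_.MDifferentiable.slash hf k _
  have hbd : UpperHalfPlane.IsBoundedAtImInfty (f ∣[k] A) := hz.boundedAtFilter
  have h1 := hz.exp_decay_atImInfty hN' (slash_Gamma_periodic hinv A) hdiff hbd
  obtain ⟨C, hC, hb⟩ := h1.exists_nonneg
  obtain ⟨Y, hY⟩ := (UpperHalfPlane.atImInfty_mem _).mp hb.bound
  rw [RD_iff]
  intro R s
  set ε : ℝ := 2 * Real.pi / N with hε
  have hε0 : 0 < ε := by positivity
  have h2 : Tendsto (fun y : ℝ => y ^ s * Real.exp (-ε * y)) atTop (𝓝 0) := by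
    have := Real.tendsto_pow_mul_exp_neg_atTop_nhds_zero s
    have h3 := this.comp (tendsto_id.const_mul_atTop hε0)
    have h4 := h3.const_mul ((ε ^ s)⁻¹)
    rw [mul_zero] at h4
    refine h4.congr (fun y => ?_)
    simp only [Function.comp_apply, id, mul_pow, neg_mul]
    field_simp
  obtain ⟨Y2, hY2⟩ := eventually_atTop.mp (h2.eventually (gt_mem_nhds zero_lt_one))
  refine ⟨C, max 1 (max Y Y2), hC, le_max_left _ _, fun z hz _ => ?_⟩
  have e1 : 1 ≤ z.im := (le_max_left _ _).trans hz
  have e2 : Y ≤ z.im := (le_max_left _ _).trans ((le_max_right _ _).trans hz)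
  have e3 : Y2 ≤ z.im := (le_max_right _ _).trans ((le_max_right _ _).trans hz)
  have hz0 : 0 < z.im := by linarith
  have b1 := hY (UpperHalfPlane.ofComplex z) (by
    rw [UpperHalfPlane.ofComplex_apply_of_im_pos hz0]; exact e2)
  have b2 := hY2 z.im e3
  simp only [Set.mem_ofPred_eq] at b1
  refine b1.trans ?_
  gcongr
  rw [Real.norm_of_nonneg (Real.exp_pos _).le, le_inv_comm₀ (Real.exp_pos _) (by positivity)]
  have him : (UpperHalfPlane.ofComplex z).im = z.im := by
    rw [UpperHalfPlane.ofComplex_apply_of_im_pos hz0]; rfl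
  rw [him]
  have : -2 * Real.pi * z.im / N = -ε * z.im := by rw [hε]; ring
  rw [this]
  rw [le_inv_comm₀ (by positivity) (Real.exp_pos _), ← one_div, le_div_iff₀ (by positivity)]
  linarith

end decay

/-- The facts about `f` used below. -/
structure GoodForm (N m : ℕ) (χ : DirichletCharacter ℂ N) (f : UpperHalfPlane → ℂ) : Prop where
  hol : MDifferentiable 𝓘(ℂ) 𝓘(ℂ) f
  inv : ∀ γ ∈ CongruenceSubgroup.Gamma0 N,
    f ∣[(m + 2 : ℤ)] γ = fun z => χ ((γ.1 1 1 : ℤ) : ZMod N) * f z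
  inv1 : ∀ γ ∈ CongruenceSubgroup.Gamma N, f ∣[(m + 2 : ℤ)] γ = f
  zero : ∀ A : SL(2, ℤ), UpperHalfPlane.IsZeroAtImInfty (f ∣[(m + 2 : ℤ)] A)

lemma IsCuspFormChi.good {N m : ℕ} {χ : DirichletCharacter ℂ N} {f : UpperHalfPlane → ℂ}
    (h : IsCuspFormChi N (m + 2 : ℤ) χ f) : GoodForm N m χ f := by
  have hinv : ∀ γ ∈ CongruenceSubgroup.Gamma0 N,
      f ∣[(m + 2 : ℤ)] γ = fun z => χ ((γ.1 1 1 : ℤ) : ZMod N) * f z := by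
    intro γ hγ
    ext z
    have hd := den_ne_zero γ z.im_pos
    rw [ModularForm.SL_slash_apply, h.2.1 γ hγ z, denom_eq_den]
    change (den γ z) ^ (m + 2 : ℤ) * _ * _ * _ = _
    rw [zpow_neg]
    have := zpow_ne_zero (m + 2 : ℤ) hd
    field_simp
  refine ⟨h.1, hinv, ?_, h.2.2⟩
  intro γ hγ
  have hm := CongruenceSubgroup.Gamma_mem.mp hγ
  have h0 : γ ∈ CongruenceSubgroup.Gamma0 N := by
    rw [CongruenceSubgroup.Gamma0_mem]
    exact hm.2.2.1
  rw [hinv γ h0]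
  ext z
  rw [hm.2.2.2]
  simp

/-- `cv f i A` is the limit of the primitive of `f(z) z^i` at the cusp `A∞`. -/
lemma GoodForm.exists_cv {N m : ℕ} (hN : 0 < N) {χ : DirichletCharacter ℂ N}
    {f : UpperHalfPlane → ℂ} (h : GoodForm N m χ f) {i : ℕ} (hi : i ≤ m) (A : SL(2, ℤ)) :
    ∃ l : ℂ, RD (fun z => prim f i (mob A z) - l) := by
  refine RD.exists_limit (fun z hz => (prim_isPrim h.hol i).comp_mob hi A hz) ?_
  have h1 := RD_of_cusp hN h.hol h.inv1 A (h.zero A)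
  have h2 := (h1.affine_pow_mul ((A.1 0 0 : ℤ) : ℂ) ((A.1 0 1 : ℤ) : ℂ) i).affine_pow_mul
    ((A.1 1 0 : ℤ) : ℂ) ((A.1 1 1 : ℤ) : ℂ) (m - i)
  refine h2.congr (fun z _ => ?_)
  simp only [nmr, den]
  ring

/-- The limit of the primitive of `f(z) z^i` at the cusp `A∞`. -/
def cv (f : UpperHalfPlane → ℂ) (i : ℕ) (A : SL(2, ℤ)) : ℂ :=
  limUnder atTop (fun y : ℝ => prim f i (mob A ((0 : ℝ) + y * Complex.I)))

lemma cv_eq_of_RD {f : UpperHalfPlane → ℂ} {i : ℕ} {A : SL(2, ℤ)} {l : ℂ}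
    (h : RD (fun z => prim f i (mob A z) - l)) : cv f i A = l := by
  apply Tendsto.limUnder_eq
  have := h.tendsto (z := fun y : ℝ => (0 : ℝ) + y * Complex.I) (R := 0)
    (by simpa using! (tendsto_id : Tendsto (id : ℝ → ℝ) atTop atTop)) (by simp)
  simpa using this.add_const l

lemma GoodForm.RD_cv {N m : ℕ} (hN : 0 < N) {χ : DirichletCharacter ℂ N}
    {f : UpperHalfPlane → ℂ} (h : GoodForm N m χ f) {i : ℕ} (hi : i ≤ m) (A : SL(2, ℤ)) :
    RD (fun z => prim f i (mob A z) - cv f i A) := by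
  obtain ⟨l, hl⟩ := h.exists_cv hN hi A
  rwa [cv_eq_of_RD hl]

lemma GoodForm.tendsto_cv {N m : ℕ} (hN : 0 < N) {χ : DirichletCharacter ℂ N}
    {f : UpperHalfPlane → ℂ} (h : GoodForm N m χ f) {i : ℕ} (hi : i ≤ m) (A : SL(2, ℤ))
    (x r : ℝ) (hr : 0 < r) :
    Tendsto (fun y : ℝ => prim f i (mob A (x + (r * y : ℝ) * Complex.I))) atTop (𝓝 (cv f i A)) := by
  have := (h.RD_cv hN hi A).tendsto (z := fun y : ℝ => x + (r * y : ℝ) * Complex.I) (R := |x|)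
    (by simpa using tendsto_id.const_mul_atTop hr) (by simp)
  simpa using this.add_const (cv f i A)

lemma eventually_im_pos : ∀ᶠ y : ℝ in atTop, 0 < ((0 : ℝ) + (y : ℂ) * Complex.I : ℂ).im := by
  filter_upwards [eventually_gt_atTop 0] with y hy
  simpa using hy

lemma GoodForm.tendsto_cv0 {N m : ℕ} (hN : 0 < N) {χ : DirichletCharacter ℂ N}
    {f : UpperHalfPlane → ℂ} (h : GoodForm N m χ f) {i : ℕ} (hi : i ≤ m) (A : SL(2, ℤ)) :
    Tendsto (fun y : ℝ => prim f i (mob A ((0 : ℝ) + y * Complex.I))) atTop (𝓝 (cv f i A)) := by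
  simpa using h.tendsto_cv hN hi A 0 1 one_pos

lemma cv_add {N m : ℕ} (hN : 0 < N) {χ : DirichletCharacter ℂ N}
    {f g : UpperHalfPlane → ℂ} (hf : GoodForm N m χ f) (hg : GoodForm N m χ g)
    {i : ℕ} (hi : i ≤ m) (A : SL(2, ℤ)) : cv (f + g) i A = cv f i A + cv g i A := by
  apply Tendsto.limUnder_eq
  refine ((hf.tendsto_cv0 hN hi A).add (hg.tendsto_cv0 hN hi A)).congr' ?_
  filter_upwards [eventually_im_pos] with y hy
  rw [prim_add hf.hol hg.hol i (mob_im_pos A hy)]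

lemma cv_smul {N m : ℕ} (hN : 0 < N) {χ : DirichletCharacter ℂ N}
    {f : UpperHalfPlane → ℂ} (hf : GoodForm N m χ f) (c : ℂ)
    {i : ℕ} (hi : i ≤ m) (A : SL(2, ℤ)) : cv (c • f) i A = c * cv f i A := by
  apply Tendsto.limUnder_eq
  refine ((hf.tendsto_cv0 hN hi A).const_mul c).congr' ?_
  filter_upwards [eventually_im_pos] with y hy
  rw [prim_smul hf.hol c i (mob_im_pos A hy)]

lemma cv_mul_T {N m : ℕ} (hN : 0 < N) {χ : DirichletCharacter ℂ N}
    {f : UpperHalfPlane → ℂ} (hf : GoodForm N m χ f)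
    {i : ℕ} (hi : i ≤ m) (A : SL(2, ℤ)) : cv f i (A * ModularGroup.T) = cv f i A := by
  apply Tendsto.limUnder_eq
  refine (hf.tendsto_cv hN hi A 1 1 one_pos).congr' ?_
  filter_upwards [eventually_im_pos] with y hy
  rw [mob_mul _ _ hy]
  congr 2
  simp [mob, ModularGroup.T]
  ring

lemma cv_neg (f : UpperHalfPlane → ℂ) (i : ℕ) (A : SL(2, ℤ)) : cv f i (-A) = cv f i A := by
  unfold cv
  have : mob (-A) = mob A := by
    ext z
    simp only [mob, Matrix.SpecialLinearGroup.coe_neg, Matrix.neg_apply, Int.cast_neg]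
    rw [← neg_div_neg_eq]
    congr 1 <;> ring
  rw [this]

/-! ### Period identities -/

/-- The period of `f(z) z^i` between the cusps `A∞` and `AS∞`. -/
def per (f : UpperHalfPlane → ℂ) (i : ℕ) (A : SL(2, ℤ)) : ℂ :=
  cv f i (A * ModularGroup.S) - cv f i A

/-- `(aX+b)^i (cX+d)^(m-i)`. -/
def tpoly (γ : SL(2, ℤ)) (m i : ℕ) : Polynomial ℤ :=
  (Polynomial.C (γ.1 0 0) * Polynomial.X + Polynomial.C (γ.1 0 1)) ^ i *
    (Polynomial.C (γ.1 1 0) * Polynomial.X + Polynomial.C (γ.1 1 1)) ^ (m - i)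

lemma tpoly_natDegree (γ : SL(2, ℤ)) {m i : ℕ} (hi : i ≤ m) :
    (tpoly γ m i).natDegree < m + 1 := by
  have h1 : ∀ a b : ℤ, ∀ n : ℕ,
      ((Polynomial.C a * Polynomial.X + Polynomial.C b) ^ n).natDegree ≤ n := by
    intro a b n
    refine Polynomial.natDegree_pow_le.trans ?_
    have := Polynomial.natDegree_linear_le (a := a) (b := b)
    nlinarith
  have h2 := Polynomial.natDegree_mul_le
    (p := (Polynomial.C (γ.1 0 0) * Polynomial.X + Polynomial.C (γ.1 0 1)) ^ i)
    (q := (Polynomial.C (γ.1 1 0) * Polynomial.X + Polynomial.C (γ.1 1 1)) ^ (m - i))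
  have h3 := h1 (γ.1 0 0) (γ.1 0 1) i
  have h4 := h1 (γ.1 1 0) (γ.1 1 1) (m - i)
  unfold tpoly
  omega

lemma tpoly_eval (γ : SL(2, ℤ)) {m i : ℕ} (hi : i ≤ m) (z : ℂ) :
    nmr γ z ^ i * den γ z ^ (m - i) =
      ∑ j ∈ Finset.range (m + 1), ((tpoly γ m i).coeff j : ℂ) * z ^ j := by
  have h := Polynomial.aeval_eq_sum_range' (tpoly_natDegree γ hi) z
  simp only [zsmul_eq_mul] at h
  rw [← h]
  simp [tpoly, nmr, den]

lemma GoodForm.equivariance {N m : ℕ} {χ : DirichletCharacter ℂ N}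
    {f : UpperHalfPlane → ℂ} (hf : GoodForm N m χ f) {γ : SL(2, ℤ)}
    (hγ : γ ∈ CongruenceSubgroup.Gamma0 N) {i : ℕ} (hi : i ≤ m) :
    ∃ c : ℂ, ∀ z : ℂ, 0 < z.im → prim f i (mob γ z) =
      χ ((γ.1 1 1 : ℤ) : ZMod N) *
        (∑ j ∈ Finset.range (m + 1), ((tpoly γ m i).coeff j : ℂ) * prim f j z) + c := by
  refine prim_unique (fun z hz => (prim_isPrim hf.hol i).comp_mob hi γ hz) (fun z hz => ?_)
  rw [hf.inv γ hγ, tpoly_eval γ hi]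
  have : HasDerivAt (fun z => ∑ j ∈ Finset.range (m + 1),
      ((tpoly γ m i).coeff j : ℂ) * prim f j z)
      (∑ j ∈ Finset.range (m + 1), ((tpoly γ m i).coeff j : ℂ) *
        (f (UpperHalfPlane.ofComplex z) * z ^ j)) z :=
    HasDerivAt.fun_sum (fun j _ => (prim_isPrim hf.hol j z hz).const_mul _)
  refine (this.const_mul _).congr_deriv ?_
  rw [Finset.mul_sum, Finset.mul_sum]
  exact Finset.sum_congr rfl (fun j _ => by ring)

lemma GoodForm.cv_equivariance {N m : ℕ} (hN : 0 < N) {χ : DirichletCharacter ℂ N}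
    {f : UpperHalfPlane → ℂ} (hf : GoodForm N m χ f) {γ : SL(2, ℤ)} {i : ℕ} (hi : i ≤ m) {c : ℂ}
    (hc : ∀ z : ℂ, 0 < z.im → prim f i (mob γ z) =
      χ ((γ.1 1 1 : ℤ) : ZMod N) *
        (∑ j ∈ Finset.range (m + 1), ((tpoly γ m i).coeff j : ℂ) * prim f j z) + c)
    (A : SL(2, ℤ)) :
    cv f i (γ * A) = χ ((γ.1 1 1 : ℤ) : ZMod N) *
        (∑ j ∈ Finset.range (m + 1), ((tpoly γ m i).coeff j : ℂ) * cv f j A) + c := by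
  apply Tendsto.limUnder_eq
  have h1 : Tendsto (fun y : ℝ => χ ((γ.1 1 1 : ℤ) : ZMod N) *
        (∑ j ∈ Finset.range (m + 1), ((tpoly γ m i).coeff j : ℂ) *
          prim f j (mob A ((0 : ℝ) + y * Complex.I))) + c) atTop
      (𝓝 (χ ((γ.1 1 1 : ℤ) : ZMod N) *
        (∑ j ∈ Finset.range (m + 1), ((tpoly γ m i).coeff j : ℂ) * cv f j A) + c)) := by
    refine Tendsto.add_const _ (Tendsto.const_mul _ (tendsto_finsetSum _ (fun j hj => ?_)))
    exact (hf.tendsto_cv0 hN (by simpa [Nat.lt_succ_iff] using hj) A).const_mul _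
  refine h1.congr' ?_
  filter_upwards [eventually_im_pos] with y hy
  rw [mob_mul _ _ hy, hc _ (mob_im_pos A hy)]

lemma GoodForm.per_equivariance {N m : ℕ} (hN : 0 < N) {χ : DirichletCharacter ℂ N}
    {f : UpperHalfPlane → ℂ} (hf : GoodForm N m χ f) {γ : SL(2, ℤ)}
    (hγ : γ ∈ CongruenceSubgroup.Gamma0 N) {i : ℕ} (hi : i ≤ m) (A : SL(2, ℤ)) :
    per f i (γ * A) = χ ((γ.1 1 1 : ℤ) : ZMod N) *
        (∑ j ∈ Finset.range (m + 1), ((tpoly γ m i).coeff j : ℂ) * per f j A) := by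
  obtain ⟨c, hc⟩ := hf.equivariance hγ hi
  have h1 := hf.cv_equivariance hN hi hc A
  have h2 := hf.cv_equivariance hN hi hc (A * ModularGroup.S)
  simp only [per, mul_sub, Finset.sum_sub_distrib]
  rw [mul_assoc, h1, h2]
  ring

/-- Generation: the differences of all cusp values lie in the group generated by the periods. -/
lemma GoodForm.cv_sub_mem {N m : ℕ} (hN : 0 < N) {χ : DirichletCharacter ℂ N}
    {f : UpperHalfPlane → ℂ} (hf : GoodForm N m χ f) {i : ℕ} (hi : i ≤ m) (S : AddSubgroup ℂ)
    (hS : ∀ A, per f i A ∈ S) (A B : SL(2, ℤ)) : cv f i B - cv f i A ∈ S := by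
  have key : ∀ X : SL(2, ℤ), cv f i (A * X) - cv f i A ∈ S := by
    intro X
    have hX : X ∈ Subgroup.closure {ModularGroup.S, ModularGroup.T} := by
      rw [SpecialLinearGroup.SL2Z_generators]
      trivial
    induction hX using Subgroup.closure_induction_right with
    | one => simp
    | mul_right x hx y hy ih =>
      rcases hy with rfl | rfl
      · have := S.add_mem (hS (A * x)) ih
        rw [per] at this
        simpa [mul_assoc] using this
      · rw [← mul_assoc, cv_mul_T hN hf hi]
        exact ih
    | mul_inv_cancel x hx y hy ih =>
      rcases hy with rfl | rfl
      · have := S.sub_mem ih (hS (A * (x * ModularGroup.S⁻¹)))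
        rw [per] at this
        simpa [mul_assoc] using this
      · rw [← cv_mul_T hN hf hi]
        simpa [mul_assoc] using ih
  have := key (A⁻¹ * B)
  simpa using this

/-- Factor `(α β; 0 δ) A` as an element of `SL₂(ℤ)` times an upper triangular matrix. -/
lemma exists_Bm (α β δ : ℤ) (hα : 0 < α) (hδ : 0 < δ) (A : SL(2, ℤ)) :
    ∃ (B : SL(2, ℤ)) (x r : ℝ), 0 < r ∧ ∀ y : ℝ, 0 < y →
      ((α : ℂ) * mob A ((0 : ℝ) + y * Complex.I) + β) / δ = mob B (x + (r * y : ℝ) * Complex.I) := by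
  have hdet : A.1 0 0 * A.1 1 1 - A.1 0 1 * A.1 1 0 = 1 := by
    have := A.2
    rwa [Matrix.det_fin_two] at this
  set a := A.1 0 0 with ha
  set b := A.1 0 1 with hb
  set c := A.1 1 0 with hc
  set d := A.1 1 1 with hd
  have hne : (α * a + β * c) ≠ 0 ∨ δ * c ≠ 0 := by
    by_contra! h
    have hc0 : c = 0 := by simpa [hδ.ne'] using h.2
    have ha0 : a = 0 := by
      have := h.1
      rw [hc0] at this
      simpa [hα.ne'] using this
    rw [ha0, hc0] at hdet
    simp at hdet
  set g : ℤ := (Int.gcd (α * a + β * c) (δ * c) : ℤ) with hg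
  have hgpos : 0 < g := by
    rw [hg]
    exact_mod_cast Int.gcd_pos_iff.mpr hne
  obtain ⟨u, hu⟩ : g ∣ (α * a + β * c) := Int.gcd_dvd_left _ _
  obtain ⟨w, hw⟩ : g ∣ δ * c := Int.gcd_dvd_right _ _
  have hcop : IsCoprime u w := by
    have h1 := Int.gcd_eq_gcd_ab (α * a + β * c) (δ * c)
    rw [← hg] at h1
    refine ⟨Int.gcdA (α * a + β * c) (δ * c), Int.gcdB (α * a + β * c) (δ * c), ?_⟩
    generalize Int.gcdA (α * a + β * c) (δ * c) = s at *
    generalize Int.gcdB (α * a + β * c) (δ * c) = t at *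
    apply mul_left_cancel₀ hgpos.ne'
    rw [hu, hw] at h1
    linear_combination -h1
  obtain ⟨B, hB0, hB1⟩ := hcop.exists_SL2_col 0
  have hBdet : B.1 0 0 * B.1 1 1 - B.1 0 1 * B.1 1 0 = 1 := by
    have := B.2
    rwa [Matrix.det_fin_two] at this
  set e := B.1 0 1 with he
  set h := B.1 1 1 with hh
  rw [hB0, hB1] at hBdet
  set s : ℤ := h * (α * b + β * d) - e * (δ * d) with hs
  set t : ℤ := -w * (α * b + β * d) + u * (δ * d) with ht
  have e1 : u * s + e * t = α * b + β * d := by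
    rw [hs, ht]; linear_combination (α * b + β * d) * hBdet
  have e2 : w * s + h * t = δ * d := by
    rw [hs, ht]; linear_combination (δ * d) * hBdet
  have e3 : g * t = α * δ := by
    rw [ht]; linear_combination (α * b + β * d) * hw - (δ * d) * hu + α * δ * hdet
  have htpos : 0 < t := by
    have : 0 < g * t := by rw [e3]; positivity
    exact pos_of_mul_pos_right this hgpos.le
  have htR : (0:ℝ) < t := by exact_mod_cast htpos
  have hgR : (0:ℝ) < g := by exact_mod_cast hgpos
  refine ⟨B, s / t, g / t, by positivity, fun y hy => ?_⟩
  have hz : 0 < ((0 : ℝ) + (y : ℂ) * Complex.I : ℂ).im := by simpa using hy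
  have hdz := den_ne_zero A hz
  have hw' : 0 < (((s / t : ℝ) : ℂ) + ((g / t * y : ℝ) : ℂ) * Complex.I : ℂ).im := by
    simp only [Complex.add_im, Complex.ofReal_im, Complex.mul_im, Complex.ofReal_re, Complex.I_im,
      Complex.I_re]
    have : 0 < (g / t * y : ℝ) := by positivity
    linarith
  have hdw := den_ne_zero B hw'
  rw [mob_eq, mob_eq]
  have htC : (t : ℂ) ≠ 0 := by exact_mod_cast htpos.ne'
  have hδC : (δ : ℂ) ≠ 0 := by exact_mod_cast hδ.ne'
  set z : ℂ := (0 : ℝ) + (y : ℂ) * Complex.I with hzdef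
  have hwz : (((s / t : ℝ) : ℂ) + ((g / t * y : ℝ) : ℂ) * Complex.I : ℂ) = (g * z + s) / t := by
    rw [hzdef]
    push_cast
    field_simp
    ring
  rw [hwz] at hdw ⊢
  rw [mul_div_assoc', div_add' _ _ _ hdz, div_div, div_eq_div_iff (mul_ne_zero hdz hδC) hdw]
  simp only [nmr, den, ← ha, ← hb, ← hc, ← hd, ← he, ← hh, hB0, hB1]
  have huC : (α * a + β * c : ℂ) = g * u := by exact_mod_cast hu
  have hwC : (δ * c : ℂ) = g * w := by exact_mod_cast hw
  have e1C : (u * s + e * t : ℂ) = α * b + β * d := by exact_mod_cast e1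
  have e2C : (w * s + h * t : ℂ) = δ * d := by exact_mod_cast e2
  have k1 : (u * ((g * z + s) / t) + e : ℂ) = ((α * a + β * c) * z + (α * b + β * d)) / t := by
    rw [eq_div_iff htC]
    field_simp
    linear_combination e1C - z * huC
  have k2 : (w * ((g * z + s) / t) + h : ℂ) = (δ * (c * z + d)) / t := by
    rw [eq_div_iff htC]
    field_simp
    linear_combination e2C - z * hwC
  rw [k1, k2]
  field_simp
  ring

/-- The `SL₂(ℤ)`-part of `(α β; 0 δ) A`. -/
def Bm (α β δ : ℤ) (hα : 0 < α) (hδ : 0 < δ) (A : SL(2, ℤ)) : SL(2, ℤ) :=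
  (exists_Bm α β δ hα hδ A).choose

lemma GoodForm.tendsto_Bm {N m : ℕ} (hN : 0 < N) {χ : DirichletCharacter ℂ N}
    {f : UpperHalfPlane → ℂ} (hf : GoodForm N m χ f) {i : ℕ} (hi : i ≤ m)
    (α β δ : ℤ) (hα : 0 < α) (hδ : 0 < δ) (A : SL(2, ℤ)) :
    Tendsto (fun y : ℝ => prim f i (((α : ℂ) * mob A ((0 : ℝ) + y * Complex.I) + β) / δ)) atTop
      (𝓝 (cv f i (Bm α β δ hα hδ A))) := by
  obtain ⟨x, r, hr, h⟩ := (exists_Bm α β δ hα hδ A).choose_spec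
  refine (hf.tendsto_cv hN hi _ x r hr).congr' ?_
  filter_upwards [eventually_gt_atTop 0] with y hy
  rw [h y hy]
  rfl

/-- The averaging form of the Hecke eigenvalue equation. -/
def HeckeEq (N p m : ℕ) (χ : DirichletCharacter ℂ N) (lam : ℂ) (f : UpperHalfPlane → ℂ) : Prop :=
  ∀ z : ℂ, 0 < z.im → lam * f (UpperHalfPlane.ofComplex z) =
    (1 / (p : ℂ)) * (∑ b ∈ Finset.range p, f (UpperHalfPlane.ofComplex ((z + b) / p))) +
      χ (p : ZMod N) * (p : ℂ) ^ (m + 1) * f (UpperHalfPlane.ofComplex (p * z))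

lemma GoodForm.hecke_prim {N p m : ℕ} (hp : 0 < p) {χ : DirichletCharacter ℂ N} {lam : ℂ}
    {f : UpperHalfPlane → ℂ} (hf : GoodForm N m χ f) (hT : HeckeEq N p m χ lam f)
    {i : ℕ} (hi : i ≤ m) :
    ∃ c : ℂ, ∀ z : ℂ, 0 < z.im → lam * prim f i z =
      (∑ b ∈ Finset.range p, ∑ j ∈ Finset.range (i + 1),
        (((i.choose j : ℤ) * (p : ℤ) ^ j * (-(b : ℤ)) ^ (i - j) : ℤ) : ℂ) *
          prim f j ((z + b) / p)) +
      χ (p : ZMod N) * (p : ℂ) ^ (m - i) * prim f i (p * z) + c := by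
  have hpC : (p : ℂ) ≠ 0 := by exact_mod_cast hp.ne'
  have hpR : (0 : ℝ) < p := by exact_mod_cast hp
  refine prim_unique (fun z hz => (prim_isPrim hf.hol i z hz).const_mul lam) (fun z hz => ?_)
  have h1 : ∀ (b j : ℕ), HasDerivAt (fun z : ℂ => prim f j ((z + b) / p))
      (f (UpperHalfPlane.ofComplex ((z + b) / p)) * ((z + b) / p) ^ j * (1 / p)) z := by
    intro b j
    have hw : 0 < ((z + b) / p : ℂ).im := by
      rw [Complex.div_natCast_im]
      have : (z + b : ℂ).im = z.im := by simp
      rw [this]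
      positivity
    have hd : HasDerivAt (fun z : ℂ => (z + b) / p) (1 / p : ℂ) z :=
      ((hasDerivAt_id z).add_const (b : ℂ)).div_const (p : ℂ)
    exact (prim_isPrim hf.hol j _ hw).comp z hd
  have h2 : HasDerivAt (fun z : ℂ => prim f i (p * z))
      (f (UpperHalfPlane.ofComplex (p * z)) * (p * z) ^ i * (p * 1)) z := by
    have hw : 0 < (p * z : ℂ).im := by
      have : (p * z : ℂ).im = p * z.im := by simp
      rw [this]
      positivity
    have hd : HasDerivAt (fun z : ℂ => (p : ℂ) * z) ((p : ℂ) * 1) z :=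
      (hasDerivAt_id z).const_mul (p : ℂ)
    exact (prim_isPrim hf.hol i _ hw).comp z hd
  have h3 : HasDerivAt (fun z : ℂ => (∑ b ∈ Finset.range p, ∑ j ∈ Finset.range (i + 1),
        (((i.choose j : ℤ) * (p : ℤ) ^ j * (-(b : ℤ)) ^ (i - j) : ℤ) : ℂ) *
          prim f j ((z + b) / p)))
      (∑ b ∈ Finset.range p, ∑ j ∈ Finset.range (i + 1),
        (((i.choose j : ℤ) * (p : ℤ) ^ j * (-(b : ℤ)) ^ (i - j) : ℤ) : ℂ) *
          (f (UpperHalfPlane.ofComplex ((z + b) / p)) * ((z + b) / p) ^ j * (1 / p))) z :=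
    HasDerivAt.fun_sum (fun b _ => HasDerivAt.fun_sum (fun j _ => (h1 b j).const_mul _))
  refine (h3.fun_add (h2.const_mul (χ (p : ZMod N) * (p : ℂ) ^ (m - i)))).congr_deriv ?_
  symm
  rw [← mul_assoc lam, hT z hz, add_mul]
  congr 1
  · rw [Finset.mul_sum, Finset.sum_mul]
    refine Finset.sum_congr rfl (fun b _ => ?_)
    have hz' : z = p * ((z + b) / p) + (-(b : ℂ)) := by field_simp; ring
    generalize f (UpperHalfPlane.ofComplex ((z + b) / p)) = fw
    have hzi : z ^ i = ∑ j ∈ Finset.range (i + 1),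
        (p * ((z + b) / p)) ^ j * (-(b : ℂ)) ^ (i - j) * (i.choose j) := by
      rw [← add_pow, ← hz']
    rw [hzi, Finset.mul_sum]
    refine Finset.sum_congr rfl (fun j _ => ?_)
    push_cast
    rw [mul_pow]
    ring
  · have : (p : ℂ) ^ (m + 1) = (p : ℂ) ^ (m - i) * (p : ℂ) ^ i * p := by
      rw [← pow_add, Nat.sub_add_cancel hi, pow_succ]
    rw [this, mul_pow]
    ring

/-- Difference of the cusp values of the image path under `(α β; 0 δ)`. -/
def Dm (f : UpperHalfPlane → ℂ) (j : ℕ) (α β δ : ℤ) (hα : 0 < α) (hδ : 0 < δ) (A : SL(2, ℤ)) : ℂ :=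
  cv f j (Bm α β δ hα hδ (A * ModularGroup.S)) - cv f j (Bm α β δ hα hδ A)

lemma GoodForm.hecke_per {N p m : ℕ} (hN : 0 < N) (hp : 0 < (p : ℤ)) {χ : DirichletCharacter ℂ N}
    {lam : ℂ} {f : UpperHalfPlane → ℂ} (hf : GoodForm N m χ f) (hT : HeckeEq N p m χ lam f)
    {i : ℕ} (hi : i ≤ m) (A : SL(2, ℤ)) :
    lam * per f i A =
      (∑ b ∈ Finset.range p, ∑ j ∈ Finset.range (i + 1),
        (((i.choose j : ℤ) * (p : ℤ) ^ j * (-(b : ℤ)) ^ (i - j) : ℤ) : ℂ) *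
          Dm f j 1 b p one_pos hp A) +
      χ (p : ZMod N) * (p : ℂ) ^ (m - i) * Dm f i p 0 1 hp one_pos A := by
  obtain ⟨c, hc⟩ := hf.hecke_prim (by exact_mod_cast hp) hT hi
  have key : ∀ A : SL(2, ℤ), lam * cv f i A =
      (∑ b ∈ Finset.range p, ∑ j ∈ Finset.range (i + 1),
        (((i.choose j : ℤ) * (p : ℤ) ^ j * (-(b : ℤ)) ^ (i - j) : ℤ) : ℂ) *
          cv f j (Bm 1 b p one_pos hp A)) +
      χ (p : ZMod N) * (p : ℂ) ^ (m - i) * cv f i (Bm p 0 1 hp one_pos A) + c := by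
    intro A
    refine tendsto_nhds_unique ((hf.tendsto_cv0 hN hi A).const_mul lam) ?_
    have h1 := tendsto_finsetSum (Finset.range p) (fun b _ =>
      tendsto_finsetSum (Finset.range (i + 1)) (fun j hj =>
        (hf.tendsto_Bm hN (i := j) (by have := Finset.mem_range.mp hj; omega)
          1 b p one_pos hp A).const_mul
        (((i.choose j : ℤ) * (p : ℤ) ^ j * (-(b : ℤ)) ^ (i - j) : ℤ) : ℂ)))
    have h2 := (hf.tendsto_Bm hN hi p 0 1 hp one_pos A).const_mul
      (χ (p : ZMod N) * (p : ℂ) ^ (m - i))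
    refine ((h1.add h2).add_const c).congr' ?_
    filter_upwards [eventually_im_pos] with y hy
    rw [hc _ (mob_im_pos A hy)]
    simp
  have k1 := key A
  have k2 := key (A * ModularGroup.S)
  simp only [Dm, per, mul_sub, Finset.sum_sub_distrib]
  rw [k1, k2]
  ring

/-! ### Injectivity of the period map -/

lemma const_imp_zero {F : ℕ → ℂ → ℂ} {φ : ℂ → ℂ}
    (hF : ∀ i, ∀ z : ℂ, 0 < z.im → HasDerivAt (F i) (φ z * z ^ i) z) (j : ℕ) :
    ∀ c : ℂ, (∀ z : ℂ, 0 < z.im →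
      ∑ i ∈ Finset.range (j + 1), (j.choose i : ℂ) * (-z) ^ (j - i) * F i z = c) →
    ∀ z : ℂ, 0 < z.im → φ z = 0 := by
  have hopen : IsOpen {z : ℂ | 0 < z.im} := isOpen_lt continuous_const Complex.continuous_im
  induction j with
  | zero =>
    intro c h z hz
    have h1 := hF 0 z hz
    have h2 : HasDerivAt (F 0) 0 z := by
      refine (hasDerivAt_const z c).congr_of_eventuallyEq ?_
      filter_upwards [hopen.mem_nhds hz] with w hw
      have := h w hw
      simpa using this
    have := h1.unique h2
    simpa using this
  | succ j ih =>
    intro c h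
    refine ih 0 (fun z hz => ?_)
    have h2 : HasDerivAt (fun z : ℂ => ∑ i ∈ Finset.range (j + 1 + 1),
        ((j + 1).choose i : ℂ) * (-z) ^ (j + 1 - i) * F i z) 0 z := by
      refine (hasDerivAt_const z c).congr_of_eventuallyEq ?_
      filter_upwards [hopen.mem_nhds hz] with w hw
      exact h w hw
    have h1 : HasDerivAt (fun z : ℂ => ∑ i ∈ Finset.range (j + 1 + 1),
        ((j + 1).choose i : ℂ) * (-z) ^ (j + 1 - i) * F i z)
        (∑ i ∈ Finset.range (j + 1 + 1),
          ((((j + 1).choose i : ℂ) * (((j + 1 - i : ℕ) : ℂ) * (-z) ^ (j + 1 - i - 1) * (-1))) * F i z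
          + ((j + 1).choose i : ℂ) * (-z) ^ (j + 1 - i) * (φ z * z ^ i))) z := by
      refine HasDerivAt.fun_sum (fun i _ => ?_)
      exact (((hasDerivAt_neg z).pow (j + 1 - i)).const_mul _).mul (hF i z hz)
    have h3 := h1.unique h2
    rw [Finset.sum_add_distrib] at h3
    have h4 : ∑ i ∈ Finset.range (j + 1 + 1),
        ((j + 1).choose i : ℂ) * (-z) ^ (j + 1 - i) * (φ z * z ^ i) = 0 := by
      have := add_pow z (-z) (j + 1)
      rw [add_neg_cancel, zero_pow (Nat.succ_ne_zero j)] at this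
      calc _ = φ z * ∑ i ∈ Finset.range (j + 1 + 1),
            z ^ i * (-z) ^ (j + 1 - i) * ((j + 1).choose i : ℂ) := by
            rw [Finset.mul_sum]
            exact Finset.sum_congr rfl (fun i _ => by ring)
        _ = 0 := by rw [← this, mul_zero]
    rw [h4, add_zero, Finset.sum_range_succ] at h3
    have h5 : ∑ i ∈ Finset.range (j + 1), (((j + 1).choose i : ℂ) *
        (((j + 1 - i : ℕ) : ℂ) * (-z) ^ (j + 1 - i - 1) * (-1))) * F i z =
        -((j : ℂ) + 1) * ∑ i ∈ Finset.range (j + 1), (j.choose i : ℂ) * (-z) ^ (j - i) * F i z := by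
      rw [Finset.mul_sum]
      refine Finset.sum_congr rfl (fun i _ => ?_)
      have e1 : (j.choose i : ℂ) * (j + 1) = ((j + 1).choose i : ℂ) * ((j + 1 - i : ℕ) : ℂ) := by
        exact_mod_cast Nat.choose_mul_succ_eq j i
      have e2 : j + 1 - i - 1 = j - i := by omega
      rw [e2]
      linear_combination (-z) ^ (j - i) * F i z * e1
    rw [h5] at h3
    simp only [Nat.sub_self, Nat.cast_zero, zero_mul, mul_zero, add_zero] at h3
    have hj : -((j : ℂ) + 1) ≠ 0 := by
      rw [neg_ne_zero]
      exact_mod_cast Nat.succ_ne_zero j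
    exact (mul_eq_zero.mp h3).resolve_left hj

lemma bounded_of_RD_periodic {N : ℕ} (hN : 0 < N) {φ : UpperHalfPlane → ℂ}
    (h1 : RD (fun z => φ (UpperHalfPlane.ofComplex z)))
    (h2 : Function.Periodic (φ ∘ UpperHalfPlane.ofComplex) (N : ℝ)) :
    UpperHalfPlane.IsBoundedAtImInfty φ := by
  rw [UpperHalfPlane.isBoundedAtImInfty_iff]
  obtain ⟨C, Y, hC, hY1, h⟩ := RD_iff.mp h1 N 0
  refine ⟨C, Y, fun z hz => ?_⟩
  have hNR : (0 : ℝ) < N := by exact_mod_cast hN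
  set n : ℤ := ⌊z.re / N⌋ with hn
  have e1 := h2.sub_int_mul_eq n (x := (z : ℂ))
  have e2 : φ z = φ (UpperHalfPlane.ofComplex ((z : ℂ) - n * ((N : ℝ) : ℂ))) := by
    simp only [Function.comp_apply, UpperHalfPlane.ofComplex_apply] at e1
    exact e1.symm
  rw [e2]
  have := h ((z : ℂ) - n * ((N : ℝ) : ℂ)) (by simpa using hz) ?_
  · simpa using this
  · have e3 : ((z : ℂ) - n * ((N : ℝ) : ℂ)).re = z.re - n * N := by simp
    rw [e3]
    have f1 := Int.floor_le (z.re / N)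
    have f2 := Int.lt_floor_add_one (z.re / N)
    rw [← hn] at f1 f2
    rw [le_div_iff₀ hNR] at f1
    rw [div_lt_iff₀ hNR] at f2
    rw [abs_le]
    constructor <;> nlinarith

/-- The negative weight form attached to the primitives `F i`. -/
def gform (m : ℕ) (F : ℕ → ℂ → ℂ) (z : ℂ) : ℂ :=
  ∑ i ∈ Finset.range (m + 1), (m.choose i : ℂ) * (-z) ^ (m - i) * F i z

lemma gform_slash (m : ℕ) (F : ℕ → ℂ → ℂ) (A : SL(2, ℤ)) {z : ℂ} (hz : 0 < z.im) :
    ((fun w : UpperHalfPlane => gform m F w) ∣[(-m : ℤ)] A) (UpperHalfPlane.ofComplex z) =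
      ∑ i ∈ Finset.range (m + 1), (m.choose i : ℂ) * (-nmr A z) ^ (m - i) * den A z ^ i *
        F i (mob A z) := by
  rw [slash_ofComplex _ _ _ hz, UpperHalfPlane.ofComplex_apply_of_im_pos (mob_im_pos A hz)]
  simp only [gform, neg_neg, zpow_natCast]
  rw [Finset.sum_mul]
  refine Finset.sum_congr rfl (fun i hi => ?_)
  have hi' : i ≤ m := by simpa [Nat.lt_succ_iff] using hi
  have hd := den_ne_zero A hz
  have e : den A z ^ m = den A z ^ (m - i) * den A z ^ i := by
    rw [← pow_add, Nat.sub_add_cancel hi']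
  change (m.choose i : ℂ) * (-mob A z) ^ (m - i) * F i (mob A z) * _ = _
  generalize F i (mob A z) = w
  rw [e, mob_eq, ← neg_div, div_pow]
  field_simp

lemma gform_inv (m : ℕ) (F : ℕ → ℂ → ℂ) (γ : SL(2, ℤ)) {z : ℂ} (hz : 0 < z.im)
    (h : ∀ i ≤ m, F i (mob γ z) =
      ∑ j ∈ Finset.range (m + 1), ((tpoly γ m i).coeff j : ℂ) * F j z) :
    ∑ i ∈ Finset.range (m + 1), (m.choose i : ℂ) * (-nmr γ z) ^ (m - i) * den γ z ^ i *
        F i (mob γ z) = gform m F z := by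
  set L : Polynomial ℂ →ₗ[ℂ] ℂ :=
    ∑ j ∈ Finset.range (m + 1), (F j z) • Polynomial.lcoeff ℂ j with hL
  have hLapp : ∀ P : Polynomial ℂ, L P = ∑ j ∈ Finset.range (m + 1), P.coeff j * F j z := by
    intro P
    rw [hL]
    simp [mul_comm]
  have hLX : ∀ i ≤ m, L (Polynomial.X ^ i) = F i z := by
    intro i hi
    rw [hLapp]
    simp only [Polynomial.coeff_X_pow]
    rw [Finset.sum_eq_single i]
    · simp
    · intro j _ hj
      simp [hj]
    · intro h
      exact absurd (Finset.mem_range.mpr (by omega)) h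
  set U : Polynomial ℂ := Polynomial.C ((γ.1 0 0 : ℤ) : ℂ) * Polynomial.X +
    Polynomial.C ((γ.1 0 1 : ℤ) : ℂ) with hU
  set V : Polynomial ℂ := Polynomial.C ((γ.1 1 0 : ℤ) : ℂ) * Polynomial.X +
    Polynomial.C ((γ.1 1 1 : ℤ) : ℂ) with hV
  have h1 : ∀ i ≤ m, F i (mob γ z) = L (U ^ i * V ^ (m - i)) := by
    intro i hi
    rw [h i hi, hLapp]
    refine Finset.sum_congr rfl (fun j _ => ?_)
    congr 1
    have : U ^ i * V ^ (m - i) = (tpoly γ m i).map (Int.castRingHom ℂ) := by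
      simp [tpoly, hU, hV, Polynomial.map_mul, Polynomial.map_pow]
    rw [this, Polynomial.coeff_map]
    rfl
  have h2 : den γ z • U + (-nmr γ z) • V = Polynomial.X + Polynomial.C (-z) := by
    rw [hU, hV]
    simp only [Polynomial.smul_eq_C_mul]
    have hd := det_eq γ
    have e1 : den γ z * ((γ.1 0 0 : ℤ) : ℂ) + (-nmr γ z) * ((γ.1 1 0 : ℤ) : ℂ) = 1 := by
      simp only [den, nmr]
      linear_combination hd
    have e2 : den γ z * ((γ.1 0 1 : ℤ) : ℂ) + (-nmr γ z) * ((γ.1 1 1 : ℤ) : ℂ) = -z := by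
      simp only [den, nmr]
      linear_combination -z * hd
    have e1' := congrArg (Polynomial.C (R := ℂ)) e1
    have e2' := congrArg (Polynomial.C (R := ℂ)) e2
    simp only [Polynomial.C_add, Polynomial.C_mul, Polynomial.C_1] at e1' e2'
    linear_combination Polynomial.X * e1' + e2'
  have h3 : ∑ i ∈ Finset.range (m + 1), (m.choose i : ℂ) * (-nmr γ z) ^ (m - i) * den γ z ^ i *
        F i (mob γ z) = L ((den γ z • U + (-nmr γ z) • V) ^ m) := by
    rw [add_pow, map_sum]
    refine Finset.sum_congr rfl (fun i hi => ?_)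
    have hi' : i ≤ m := by simpa [Nat.lt_succ_iff] using hi
    rw [h1 i hi', smul_pow, smul_pow, smul_mul_smul_comm, smul_mul_assoc, map_smul]
    have : U ^ i * V ^ (m - i) * (m.choose i : Polynomial ℂ) =
        (m.choose i : ℂ) • (U ^ i * V ^ (m - i)) := by
      rw [Polynomial.smul_eq_C_mul, mul_comm]
      simp
    rw [this, map_smul, smul_eq_mul, smul_eq_mul]
    ring
  rw [h3, h2, add_pow, map_sum, gform]
  refine Finset.sum_congr rfl (fun i hi => ?_)
  have hi' : i ≤ m := by simpa [Nat.lt_succ_iff] using hi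
  have : Polynomial.X ^ i * Polynomial.C (-z) ^ (m - i) * (m.choose i : Polynomial ℂ) =
      ((m.choose i : ℂ) * (-z) ^ (m - i)) • Polynomial.X ^ i := by
    rw [Polynomial.smul_eq_C_mul]
    simp only [Polynomial.C_mul, Polynomial.C_pow, Polynomial.C_eq_natCast, map_natCast]
    ring
  rw [this, map_smul, hLX i hi', smul_eq_mul]

lemma GoodForm.eq_zero {N m : ℕ} (hN : 0 < N) {χ : DirichletCharacter ℂ N}
    {f : UpperHalfPlane → ℂ} (hf : GoodForm N m χ f)
    (hper : ∀ i ≤ m, ∀ A, per f i A = 0) : f = 0 := by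
  have : NeZero N := ⟨hN.ne'⟩
  have hcv : ∀ i ≤ m, ∀ A, cv f i A = cv f i 1 := by
    intro i hi A
    have := hf.cv_sub_mem hN hi ⊥ (fun A => by simp [hper i hi A]) 1 A
    rw [AddSubgroup.mem_bot] at this
    linear_combination this
  set F : ℕ → ℂ → ℂ := fun i z => prim f i z - cv f i 1 with hF
  have hFd : ∀ i, ∀ z : ℂ, 0 < z.im →
      HasDerivAt (F i) (f (UpperHalfPlane.ofComplex z) * z ^ i) z :=
    fun i z hz => (prim_isPrim hf.hol i z hz).sub_const _
  have hFRD : ∀ i ≤ m, ∀ A, RD (fun z => F i (mob A z)) := by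
    intro i hi A
    have := hf.RD_cv hN hi A
    rwa [hcv i hi A] at this
  have hFinv : ∀ γ ∈ CongruenceSubgroup.Gamma N, ∀ i ≤ m, ∀ z : ℂ, 0 < z.im → F i (mob γ z) =
      ∑ j ∈ Finset.range (m + 1), ((tpoly γ m i).coeff j : ℂ) * F j z := by
    intro γ hγ i hi z hz
    have hm := CongruenceSubgroup.Gamma_mem.mp hγ
    have h0 : γ ∈ CongruenceSubgroup.Gamma0 N := by
      rw [CongruenceSubgroup.Gamma0_mem]
      exact hm.2.2.1
    obtain ⟨c, hc⟩ := hf.equivariance h0 hi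
    have h1 := hf.cv_equivariance hN hi hc 1
    have h2 := hc z hz
    have hχ : χ ((γ.1 1 1 : ℤ) : ZMod N) = 1 := by
      rw [hm.2.2.2]
      simp
    rw [hχ, one_mul] at h1 h2
    rw [hcv i hi] at h1
    simp only [hF, mul_sub, Finset.sum_sub_distrib]
    rw [h2]
    linear_combination -h1
  set g : UpperHalfPlane → ℂ := fun w => gform m F w with hg
  have hginv : ∀ γ ∈ CongruenceSubgroup.Gamma N, g ∣[(-m : ℤ)] γ = g := by
    intro γ hγ
    ext w
    have hw : 0 < (w : ℂ).im := w.im_pos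
    have h1 := gform_slash m F γ hw
    rw [gform_inv m F γ hw (fun i hi => hFinv γ hγ i hi _ hw), UpperHalfPlane.ofComplex_apply] at h1
    exact h1
  have hghol : MDifferentiable 𝓘(ℂ) 𝓘(ℂ) g := by
    rw [UpperHalfPlane.mdifferentiable_iff]
    have : DifferentiableOn ℂ (gform m F) {z | 0 < z.im} := by
      intro z hz
      apply DifferentiableAt.differentiableWithinAt
      unfold gform
      refine DifferentiableAt.fun_sum (fun i _ => ?_)
      have := (hFd i z hz).differentiableAt
      fun_prop
    refine this.congr (fun z hz => ?_)
    simp only [Function.comp_apply, hg]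
    rw [UpperHalfPlane.ofComplex_apply_of_im_pos hz]
  have hgbd : ∀ A : SL(2, ℤ), UpperHalfPlane.IsBoundedAtImInfty (g ∣[(-m : ℤ)] A) := by
    intro A
    refine bounded_of_RD_periodic hN ?_ (slash_Gamma_periodic hginv A)
    have h1 : RD (fun z => ∑ i ∈ Finset.range (m + 1), (m.choose i : ℂ) * (-nmr A z) ^ (m - i) *
        den A z ^ i * F i (mob A z)) := by
      refine RD.sum _ (fun i hi => ?_)
      have hi' : i ≤ m := by simpa [Nat.lt_succ_iff] using hi
      have h2 := (((hFRD i hi' A).affine_pow_mul ((A.1 1 0 : ℤ) : ℂ) ((A.1 1 1 : ℤ) : ℂ)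
        i).affine_pow_mul (-((A.1 0 0 : ℤ) : ℂ)) (-((A.1 0 1 : ℤ) : ℂ)) (m - i)).const_mul
          (m.choose i : ℂ)
      refine h2.congr (fun z _ => ?_)
      simp only [nmr, den]
      ring
    exact h1.congr (fun z hz => (gform_slash m F A hz).symm)
  let G : ModularForm ((CongruenceSubgroup.Gamma N : Subgroup SL(2, ℤ)) :
      Subgroup (GL (Fin 2) ℝ)) (-m : ℤ) :=
    { toFun := g
      slash_action_eq' := by
        rintro _ ⟨γ, hγ, rfl⟩
        exact hginv γ hγ
      holo' := hghol
      bdd_at_cusps' := by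
        intro c hc
        rw [Subgroup.IsArithmetic.isCusp_iff_isCusp_SL2Z] at hc
        rw [OnePoint.isBoundedAt_iff_forall_SL2Z hc]
        intro γ _
        exact hgbd γ }
  have hconst : ∃ c, g = Function.const _ c := by
    rcases Nat.eq_zero_or_pos m with hm | hm
    · subst hm
      exact ModularForm.eq_const_of_weight_zero G
    · have := ModularForm.isZero_of_neg_weight (by simpa using hm) G
      refine ⟨0, ?_⟩
      have h2 : (G : UpperHalfPlane → ℂ) = 0 := by rw [this]; rfl
      exact h2
  obtain ⟨c, hc⟩ := hconst
  have hfin := const_imp_zero hFd m c (fun z hz => by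
    have := congrFun hc (UpperHalfPlane.ofComplex z)
    simp only [hg, Function.const_apply] at this
    rwa [UpperHalfPlane.ofComplex_apply_of_im_pos hz] at this)
  ext w
  have := hfin w w.im_pos
  rwa [UpperHalfPlane.ofComplex_apply] at this

/-! ### The Hecke operator as an averaging operator -/

lemma eexp_add (a b : ℂ) : eexp (a + b) = eexp a * eexp b := by
  simp only [eexp, ← Complex.exp_add]
  congr 1
  ring

lemma eexp_nat_mul (n : ℕ) (z : ℂ) : eexp (n * z) = eexp z ^ n := by
  simp only [eexp, ← Complex.exp_nat_mul]
  congr 1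
  ring

lemma GoodForm.periodic {N m : ℕ} {χ : DirichletCharacter ℂ N}
    {f : UpperHalfPlane → ℂ} (hf : GoodForm N m χ f) :
    Function.Periodic (f ∘ UpperHalfPlane.ofComplex) ((1 : ℝ) : ℂ) := by
  have hT1 : ModularGroup.T.1 = !![1, 1; 0, 1] := ModularGroup.coe_T
  have hT : ModularGroup.T ∈ CongruenceSubgroup.Gamma0 N := by
    rw [CongruenceSubgroup.Gamma0_mem]
    simp only [hT1]
    simp
  have hinv := hf.inv _ hT
  intro z
  by_cases hz : 0 < z.im
  · have := congrFun hinv (UpperHalfPlane.ofComplex z)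
    rw [slash_ofComplex _ _ _ hz] at this
    have hd : den ModularGroup.T z = 1 := by
      simp only [den, hT1]
      simp
    have hm : mob ModularGroup.T z = z + (1 : ℝ) := by
      simp only [mob, hT1]
      simp
    have hχ : χ ((ModularGroup.T.1 1 1 : ℤ) : ZMod N) = 1 := by
      simp only [hT1]
      simp
    rw [hd, hm, one_zpow, mul_one, hχ, one_mul] at this
    exact this
  · have h1 : z.im ≤ 0 := not_lt.mp hz
    have h2 : (z + ((1 : ℝ) : ℂ)).im ≤ 0 := by simpa using h1
    simp only [Function.comp_apply]
    rw [UpperHalfPlane.ofComplex_apply_of_im_nonpos h1,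
      UpperHalfPlane.ofComplex_apply_of_im_nonpos h2]

lemma GoodForm.zero_infty {N m : ℕ} {χ : DirichletCharacter ℂ N}
    {f : UpperHalfPlane → ℂ} (hf : GoodForm N m χ f) : UpperHalfPlane.IsZeroAtImInfty f := by
  have := hf.zero 1
  rwa [SlashAction.slash_one] at this

lemma GoodForm.fCoeff_eq {N m : ℕ} {χ : DirichletCharacter ℂ N}
    {f : UpperHalfPlane → ℂ} (hf : GoodForm N m χ f) (n : ℕ) :
    fCoeff f n = (UpperHalfPlane.qExpansion 1 f).coeff n := by
  rw [UpperHalfPlane.qExpansion_coeff_eq_intervalIntegral one_pos hf.periodic hf.hol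
    hf.zero_infty.boundedAtFilter n one_pos, fCoeff]
  simp only [Complex.ofReal_one, div_one, one_mul]
  congr 1
  ext x
  change _ = 1 / Function.Periodic.qParam 1 ((x : ℂ) + Complex.I) ^ n * f (pt x)
  rw [mul_comm]
  congr 1
  rw [one_div, Function.Periodic.qParam, eexp, ← Complex.exp_nat_mul, ← Complex.exp_neg]
  congr 1
  simp
  ring

lemma GoodForm.fCoeff_zero {N m : ℕ} {χ : DirichletCharacter ℂ N}
    {f : UpperHalfPlane → ℂ} (hf : GoodForm N m χ f) : fCoeff f 0 = 0 := by
  rw [hf.fCoeff_eq, UpperHalfPlane.qExpansion_coeff_zero one_pos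
    (UpperHalfPlane.analyticAt_cuspFunction_zero one_pos hf.periodic hf.hol
      hf.zero_infty.boundedAtFilter) hf.periodic]
  exact hf.zero_infty.valueAtInfty_eq_zero

lemma GoodForm.hasSum {N m : ℕ} {χ : DirichletCharacter ℂ N}
    {f : UpperHalfPlane → ℂ} (hf : GoodForm N m χ f) {z : ℂ} (hz : 0 < z.im) :
    HasSum (fun n : ℕ => fCoeff f n * eexp (n * z)) (f (UpperHalfPlane.ofComplex z)) := by
  have := UpperHalfPlane.hasSum_qExpansion one_pos hf.periodic hf.hol
    hf.zero_infty.boundedAtFilter (UpperHalfPlane.ofComplex z)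
  refine this.congr_fun (fun n => ?_)
  rw [hf.fCoeff_eq, eexp_nat_mul, smul_eq_mul, UpperHalfPlane.ofComplex_apply_of_im_pos hz]
  congr 2
  simp [Function.Periodic.qParam, eexp]

lemma sum_roots (p : ℕ) (hp : 0 < p) (n : ℕ) :
    ∑ b ∈ Finset.range p, eexp (n * ((b : ℂ) / p)) = if p ∣ n then (p : ℂ) else 0 := by
  have hpC : (p : ℂ) ≠ 0 := by exact_mod_cast hp.ne'
  have hprim := Complex.isPrimitiveRoot_exp p hp.ne'
  set ζ := Complex.exp (2 * Real.pi * Complex.I / p) with hζ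
  have h1 : ∀ b : ℕ, eexp (n * ((b : ℂ) / p)) = (ζ ^ n) ^ b := by
    intro b
    rw [hζ, ← Complex.exp_nat_mul, ← Complex.exp_nat_mul, eexp]
    congr 1
    ring
  simp only [h1]
  split_ifs with h
  · rw [(hprim.pow_eq_one_iff_dvd n).mpr h]
    simp
  · have hne : ζ ^ n ≠ 1 := fun h' => h ((hprim.pow_eq_one_iff_dvd n).mp h')
    rw [geom_sum_eq hne, ← pow_mul, mul_comm, pow_mul, hprim.pow_eq_one]
    simp

lemma GoodForm.heckeEq {N p m : ℕ} (hp : 0 < p) {χ : DirichletCharacter ℂ N} {lam : ℂ}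
    {f : UpperHalfPlane → ℂ} (hf : GoodForm N m χ f)
    (hT : heckeT N p (m + 2 : ℤ) χ f = fun z => lam * f z) : HeckeEq N p m χ lam f := by
  intro z hz
  have hpC : (p : ℂ) ≠ 0 := by exact_mod_cast hp.ne'
  have hpR : (0 : ℝ) < p := by exact_mod_cast hp
  have h0 := congrFun hT (UpperHalfPlane.ofComplex z)
  rw [← h0, heckeT, UpperHalfPlane.ofComplex_apply_of_im_pos hz]
  have hs : ∀ h : ℕ → ℂ, ∀ s : ℂ, h 0 = 0 → HasSum h s → HasSum (fun n => h (n + 1)) s := by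
    intro h s h0 hh
    have := (hasSum_nat_add_iff' 1).mpr hh
    simpa [h0] using this
  congr 1
  · have h1 : HasSum (fun n : ℕ => ∑ b ∈ Finset.range p, fCoeff f n * eexp (n * ((z + b) / p)))
        (∑ b ∈ Finset.range p, f (UpperHalfPlane.ofComplex ((z + b) / p))) := by
      refine hasSum_sum (fun b _ => hf.hasSum ?_)
      rw [Complex.div_natCast_im]
      have : (z + b : ℂ).im = z.im := by simp
      rw [this]
      positivity
    have h2 := h1.mul_left (1 / (p : ℂ))
    have h3 : HasSum (fun n : ℕ => if p ∣ n then fCoeff f n * eexp (n * (z / p)) else 0)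
        ((1 / (p : ℂ)) * ∑ b ∈ Finset.range p, f (UpperHalfPlane.ofComplex ((z + b) / p))) := by
      refine h2.congr_fun (fun n => ?_)
      have e1 : ∀ b : ℕ, fCoeff f n * eexp (n * ((z + b) / p)) =
          fCoeff f n * eexp (n * (z / p)) * eexp (n * ((b : ℂ) / p)) := by
        intro b
        rw [mul_assoc, ← eexp_add]
        congr 2
        ring
      simp only [e1]
      rw [← Finset.mul_sum, sum_roots p hp n]
      split_ifs
      · field_simp
      · simp
    have hinj : Function.Injective (fun n : ℕ => n * p) := fun a b h =>
      Nat.eq_of_mul_eq_mul_right hp h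
    have h4 := (hinj.hasSum_iff (f := fun n : ℕ => if p ∣ n then fCoeff f n * eexp (n * (z / p)) else 0)
      (fun x hx => by
        rw [if_neg]
        rintro ⟨y, rfl⟩
        exact hx ⟨y, mul_comm _ _⟩)).mpr h3
    have h5 := hs _ _ (by simp [hf.fCoeff_zero]) h4
    rw [← h5.tsum_eq]
    refine tsum_congr (fun n => ?_)
    simp only [Function.comp_apply, dvd_mul_left, if_true]
    congr 2
    push_cast
    field_simp
  · have hw : 0 < (p * z : ℂ).im := by
      have : (p * z : ℂ).im = p * z.im := by simp
      rw [this]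
      positivity
    have h5 := hs _ _ (by simp [hf.fCoeff_zero]) (hf.hasSum hw)
    rw [← h5.tsum_eq]
    have e : (p : ℂ) ^ ((m : ℤ) + 2 - 1) = (p : ℂ) ^ (m + 1) := by
      rw [← zpow_natCast]
      congr 1
      push_cast
      ring
    rw [e, mul_comm ((p : ℂ) ^ (m + 1))]
    congr 1
    refine tsum_congr (fun n => ?_)
    congr 2
    push_cast
    ring

/-! ### Valuations -/

lemma IsPadicValuation.of_pow_eq_one {p : ℕ} {v : ℂ → ℝ} (hv : IsPadicValuation p v) {u : ℂ}
    {n : ℕ} (hn : n ≠ 0) (hu : u ^ n = 1) : v u = 0 := by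
  have hu0 : u ≠ 0 := by
    rintro rfl
    rw [zero_pow hn] at hu
    exact zero_ne_one hu
  have h : ∀ k : ℕ, v (u ^ k) = k * v u := by
    intro k
    induction k with
    | zero => simp [hv.map_one]
    | succ k ih =>
      rw [pow_succ, hv.map_mul _ _ (pow_ne_zero _ hu0) hu0, ih]
      push_cast
      ring
  have h1 := h n
  rw [hu, hv.map_one] at h1
  have hn' : (n : ℝ) ≠ 0 := by exact_mod_cast hn
  rcases mul_eq_zero.mp h1.symm with h2 | h2
  · exact absurd h2 hn'
  · exact h2

/-- The additive group of elements of valuation at least `M`. -/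
def vsub {p : ℕ} {v : ℂ → ℝ} (hv : IsPadicValuation p v) (M : ℝ) : AddSubgroup ℂ where
  carrier := {x | x = 0 ∨ M ≤ v x}
  zero_mem' := Or.inl rfl
  add_mem' := by
    rintro x y hx hy
    by_cases hx0 : x = 0
    · simpa [hx0] using hy
    by_cases hy0 : y = 0
    · simpa [hy0] using hx
    by_cases hxy : x + y = 0
    · exact Or.inl hxy
    · refine Or.inr (le_trans (le_min ?_ ?_) (hv.nonarch x y hx0 hy0 hxy))
      · exact hx.resolve_left hx0
      · exact hy.resolve_left hy0
  neg_mem' := by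
    rintro x hx
    by_cases hx0 : x = 0
    · exact Or.inl (by simp [hx0])
    · right
      have h1 : v (-1) = 0 := hv.of_pow_eq_one two_ne_zero (by norm_num)
      have : v (-x) = v x := by
        rw [← neg_one_mul, hv.map_mul _ _ (by norm_num) hx0, h1, zero_add]
      rw [this]
      exact hx.resolve_left hx0

lemma mem_vsub {p : ℕ} {v : ℂ → ℝ} (hv : IsPadicValuation p v) {M : ℝ} {x : ℂ} :
    x ∈ vsub hv M ↔ x = 0 ∨ M ≤ v x := Iff.rfl

lemma vsub_int_mul {p : ℕ} {v : ℂ → ℝ} (hv : IsPadicValuation p v) {M : ℝ} {x : ℂ}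
    (hx : x ∈ vsub hv M) (n : ℤ) : (n : ℂ) * x ∈ vsub hv M := by
  rw [← zsmul_eq_mul]
  exact (vsub hv M).zsmul_mem hx n

lemma vsub_pow_mul {p : ℕ} {v : ℂ → ℝ} (hp : p ≠ 0) (hv : IsPadicValuation p v) {M : ℝ} {x : ℂ}
    (hx : x ∈ vsub hv M) {n j : ℕ} (hj : n ≤ j) : (p : ℂ) ^ j * x ∈ vsub hv (M + n) := by
  have hpC : (p : ℂ) ≠ 0 := by exact_mod_cast hp
  have h : ∀ k : ℕ, v ((p : ℂ) ^ k) = k := by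
    intro k
    induction k with
    | zero => simp [hv.map_one]
    | succ k ih =>
      rw [pow_succ, hv.map_mul _ _ (pow_ne_zero _ hpC) hpC, ih, hv.map_p]
      push_cast
      ring
  by_cases hx0 : x = 0
  · left; simp [hx0]
  · right
    rw [hv.map_mul _ _ (pow_ne_zero _ hpC) hx0, h]
    have := hx.resolve_left hx0
    have hj' : (n : ℝ) ≤ j := by exact_mod_cast hj
    linarith

lemma vsub_chi_mul {p N : ℕ} (hN : 0 < N) {v : ℂ → ℝ} (hv : IsPadicValuation p v) {M : ℝ} {x : ℂ}
    (hx : x ∈ vsub hv M) (χ : DirichletCharacter ℂ N) (a : ZMod N) : χ a * x ∈ vsub hv M := by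
  have : NeZero N := ⟨hN.ne'⟩
  by_cases ha : IsUnit a
  · obtain ⟨u, rfl⟩ := ha
    have h1 : (χ (u : ZMod N)) ^ (Fintype.card (ZMod N)ˣ) = 1 := by
      rw [← map_pow, ← Units.val_pow_eq_pow_val, pow_card_eq_one]
      simp
    have hne : χ (u : ZMod N) ≠ 0 := by
      intro h0
      rw [h0, zero_pow Fintype.card_ne_zero] at h1
      exact zero_ne_one h1
    by_cases hx0 : x = 0
    · left; simp [hx0]
    · right
      rw [hv.map_mul _ _ hne hx0, hv.of_pow_eq_one Fintype.card_ne_zero h1, zero_add]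
      exact hx.resolve_left hx0
  · left
    rw [χ.map_nonunit ha, zero_mul]

/-! ### Assembly -/

lemma GoodForm.zero_form (N m : ℕ) (χ : DirichletCharacter ℂ N) :
    GoodForm N m χ (0 : UpperHalfPlane → ℂ) where
  hol := mdifferentiable_const
  inv := fun γ _ => by
    rw [SlashAction.zero_slash]
    ext z
    simp
  inv1 := fun γ _ => SlashAction.zero_slash _ _
  zero := fun A => by
    rw [SlashAction.zero_slash]
    exact Filter.zero_zeroAtFilter _

lemma GoodForm.add {N m : ℕ} {χ : DirichletCharacter ℂ N} {f g : UpperHalfPlane → ℂ}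
    (hf : GoodForm N m χ f) (hg : GoodForm N m χ g) : GoodForm N m χ (f + g) where
  hol := hf.hol.add hg.hol
  inv := fun γ hγ => by
    rw [SlashAction.add_slash, hf.inv γ hγ, hg.inv γ hγ]
    ext z
    simp only [Pi.add_apply]
    ring
  inv1 := fun γ hγ => by rw [SlashAction.add_slash, hf.inv1 γ hγ, hg.inv1 γ hγ]
  zero := fun A => by
    rw [SlashAction.add_slash]
    exact (hf.zero A).add (hg.zero A)

lemma GoodForm.smul {N m : ℕ} {χ : DirichletCharacter ℂ N} {f : UpperHalfPlane → ℂ}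
    (hf : GoodForm N m χ f) (c : ℂ) : GoodForm N m χ (c • f) where
  hol := hf.hol.const_smul c
  inv := fun γ hγ => by
    rw [ModularForm.SL_smul_slash, hf.inv γ hγ]
    ext z
    simp only [Pi.smul_apply, smul_eq_mul]
    ring
  inv1 := fun γ hγ => by rw [ModularForm.SL_smul_slash, hf.inv1 γ hγ]
  zero := fun A => by
    rw [ModularForm.SL_smul_slash]
    exact (hf.zero A).smul c

/-- The eigenspace, as a submodule. -/
def eigenW (N p m : ℕ) (χ : DirichletCharacter ℂ N) (lam : ℂ) :
    Submodule ℂ (UpperHalfPlane → ℂ) where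
  carrier := {f | GoodForm N m χ f ∧ HeckeEq N p m χ lam f}
  zero_mem' := ⟨GoodForm.zero_form N m χ, fun z _ => by simp⟩
  add_mem' := by
    rintro f g ⟨hf, hf'⟩ ⟨hg, hg'⟩
    refine ⟨hf.add hg, fun z hz => ?_⟩
    have h1 := hf' z hz
    have h2 := hg' z hz
    simp only [Pi.add_apply, Finset.sum_add_distrib]
    linear_combination h1 + h2
  smul_mem' := by
    rintro c f ⟨hf, hf'⟩
    refine ⟨hf.smul c, fun z hz => ?_⟩
    have h1 := hf' z hz
    simp only [Pi.smul_apply, smul_eq_mul, ← Finset.mul_sum]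
    linear_combination c * h1

lemma Dm_add {N m : ℕ} (hN : 0 < N) {χ : DirichletCharacter ℂ N}
    {f g : UpperHalfPlane → ℂ} (hf : GoodForm N m χ f) (hg : GoodForm N m χ g)
    {i : ℕ} (hi : i ≤ m) (α β δ : ℤ) (hα : 0 < α) (hδ : 0 < δ) (A : SL(2, ℤ)) :
    Dm (f + g) i α β δ hα hδ A = Dm f i α β δ hα hδ A + Dm g i α β δ hα hδ A := by
  simp only [Dm, cv_add hN hf hg hi]
  ring

lemma Dm_smul {N m : ℕ} (hN : 0 < N) {χ : DirichletCharacter ℂ N}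
    {f : UpperHalfPlane → ℂ} (hf : GoodForm N m χ f) (c : ℂ)
    {i : ℕ} (hi : i ≤ m) (α β δ : ℤ) (hα : 0 < α) (hδ : 0 < δ) (A : SL(2, ℤ)) :
    Dm (c • f) i α β δ hα hδ A = c * Dm f i α β δ hα hδ A := by
  simp only [Dm, cv_smul hN hf c hi]
  ring

/-- The coset space. -/
abbrev Qt (N : ℕ) := SL(2, ℤ) ⧸ CongruenceSubgroup.Gamma0 N

/-- Representatives for `Γ₀(N) \ SL₂(ℤ)`. -/
def rep {N : ℕ} (q : Qt N) : SL(2, ℤ) := (Quotient.out q)⁻¹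

lemma exists_rep (N : ℕ) (A : SL(2, ℤ)) :
    ∃ q : Qt N, ∃ γ ∈ CongruenceSubgroup.Gamma0 N, A = γ * rep q := by
  refine ⟨((A⁻¹ : SL(2, ℤ)) : Qt N), A * (rep ((A⁻¹ : SL(2, ℤ)) : Qt N))⁻¹, ?_, by simp⟩
  have h : ((Quotient.out ((A⁻¹ : SL(2, ℤ)) : Qt N) : SL(2, ℤ)) : Qt N) = ((A⁻¹ : SL(2, ℤ)) : Qt N) :=
    QuotientGroup.out_eq' _
  have h2 := QuotientGroup.eq.mp h.symm
  simpa [rep] using h2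

/-- The period functionals. -/
def perMap {N : ℕ} (hN : 0 < N) (p m : ℕ) (hp : 0 < (p : ℤ)) (χ : DirichletCharacter ℂ N) (lam : ℂ)
    (n : ℕ) : eigenW N p m χ lam →ₗ[ℂ] (Qt N × Option (Fin p) × Fin n → ℂ) where
  toFun f x := match x.2.1 with
    | some b => Dm f.1 (min (x.2.2 : ℕ) m) 1 ((b : ℕ) : ℤ) p one_pos hp (rep x.1)
    | none => Dm f.1 (m - (x.2.2 : ℕ)) p 0 1 hp one_pos (rep x.1)
  map_add' := by
    rintro f g
    ext ⟨q, b, j⟩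
    cases b with
    | some b => exact Dm_add hN f.2.1 g.2.1 (min_le_right _ _) _ _ _ _ _ _
    | none => exact Dm_add hN f.2.1 g.2.1 (Nat.sub_le _ _) _ _ _ _ _ _
  map_smul' := by
    rintro c f
    ext ⟨q, b, j⟩
    cases b with
    | some b => exact Dm_smul hN f.2.1 c (min_le_right _ _) _ _ _ _ _ _
    | none => exact Dm_smul hN f.2.1 c (Nat.sub_le _ _) _ _ _ _ _ _

lemma perMap_inj {N : ℕ} (hN : 0 < N) {p m : ℕ} (hp : 0 < (p : ℤ)) (χ : DirichletCharacter ℂ N)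
    {lam : ℂ} (hlam : lam ≠ 0) {v : ℂ → ℝ} (hv : IsPadicValuation p v) {n : ℕ} (hn : v lam < n) :
    Function.Injective (perMap hN p m hp χ lam n) := by
  have : NeZero N := ⟨hN.ne'⟩
  have hp0 : p ≠ 0 := by
    rintro rfl
    simp at hp
  rw [injective_iff_map_eq_zero]
  rintro ⟨f, hfT⟩ hzero
  have hf : GoodForm N m χ f := hfT.1
  have hT : HeckeEq N p m χ lam f := hfT.2
  rw [Submodule.mk_eq_zero]
  by_contra hne
  have hD1 : ∀ q : Qt N, ∀ b ∈ Finset.range p, ∀ j ≤ m, j < n →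
      Dm f j 1 (b : ℤ) p one_pos hp (rep q) = 0 := by
    intro q b hb j hj hjn
    have := congrFun hzero (q, some ⟨b, Finset.mem_range.mp hb⟩, ⟨j, hjn⟩)
    change Dm f (min j m) 1 (b : ℤ) p one_pos hp (rep q) = 0 at this
    rwa [min_eq_left hj] at this
  have hD2 : ∀ q : Qt N, ∀ i ≤ m, m - i < n → Dm f i p 0 1 hp one_pos (rep q) = 0 := by
    intro q i hi hin
    have := congrFun hzero (q, none, ⟨m - i, hin⟩)
    change Dm f (m - (m - i)) p 0 1 hp one_pos (rep q) = 0 at this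
    rwa [Nat.sub_sub_self hi] at this
  -- a nonzero period of minimal valuation
  have hfin : Finite (Qt N) := inferInstance
  have hex : {x : Qt N × Fin (m + 1) | per f x.2 (rep x.1) ≠ 0}.Nonempty := by
    by_contra! hemp
    apply hne
    refine hf.eq_zero hN (fun i hi A => ?_)
    obtain ⟨q, γ, hγ, rfl⟩ := exists_rep N A
    rw [hf.per_equivariance hN hγ hi, Finset.sum_eq_zero, mul_zero]
    intro j hj
    have : (q, (⟨j, Finset.mem_range.mp hj⟩ : Fin (m + 1))) ∉
        {x : Qt N × Fin (m + 1) | per f x.2 (rep x.1) ≠ 0} := by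
      rw [hemp]
      simp
    have h0 : per f j (rep q) = 0 := by
      by_contra h
      exact this h
    rw [h0, mul_zero]
  obtain ⟨⟨q0, i0⟩, hx0, hmin⟩ := Set.exists_min_image _
    (fun x : Qt N × Fin (m + 1) => v (per f x.2 (rep x.1))) (Set.toFinite _) hex
  set M := v (per f i0 (rep q0)) with hM
  have hi0 : (i0 : ℕ) ≤ m := Nat.lt_succ_iff.mp i0.2
  have hx0' : per f i0 (rep q0) ≠ 0 := hx0
  have hmem0 : ∀ q : Qt N, ∀ j ∈ Finset.range (m + 1), per f j (rep q) ∈ vsub hv M := by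
    intro q j hj
    by_cases h0 : per f j (rep q) = 0
    · exact Or.inl h0
    · exact Or.inr (hmin (q, ⟨j, Finset.mem_range.mp hj⟩) h0)
  have hmem : ∀ i ≤ m, ∀ A, per f i A ∈ vsub hv M := by
    intro i hi A
    obtain ⟨q, γ, hγ, rfl⟩ := exists_rep N A
    rw [hf.per_equivariance hN hγ hi]
    exact vsub_chi_mul hN hv (AddSubgroup.sum_mem _
      (fun j hj => vsub_int_mul hv (hmem0 q j hj) _)) χ _
  have hDm : ∀ i ≤ m, ∀ α β δ : ℤ, ∀ hα : 0 < α, ∀ hδ : 0 < δ, ∀ A,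
      Dm f i α β δ hα hδ A ∈ vsub hv M := by
    intro i hi α β δ hα hδ A
    exact hf.cv_sub_mem hN hi (vsub hv M) (hmem i hi) _ _
  have hfinal : lam * per f i0 (rep q0) ∈ vsub hv (M + n) := by
    rw [hf.hecke_per hN hp hT hi0]
    refine AddSubgroup.add_mem _ (AddSubgroup.sum_mem _ (fun b hb =>
      AddSubgroup.sum_mem _ (fun j hj => ?_))) ?_
    · have hj' : j ≤ m := by
        have := Finset.mem_range.mp hj
        omega
      by_cases hjn : j < n
      · rw [hD1 q0 b hb j hj' hjn, mul_zero]
        exact AddSubgroup.zero_mem _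
      · have h1 := vsub_pow_mul hp0 hv (hDm j hj' 1 b p one_pos hp (rep q0)) (not_lt.mp hjn)
        have h2 := vsub_int_mul hv h1 (((i0 : ℕ).choose j : ℤ) * (-(b : ℤ)) ^ ((i0 : ℕ) - j))
        convert h2 using 1
        push_cast
        ring
    · by_cases hjn : m - (i0 : ℕ) < n
      · rw [hD2 q0 i0 hi0 hjn, mul_zero]
        exact AddSubgroup.zero_mem _
      · have h1 := vsub_pow_mul hp0 hv (hDm i0 hi0 p 0 1 hp one_pos (rep q0)) (not_lt.mp hjn)
        rw [mul_assoc]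
        exact vsub_chi_mul hN hv h1 χ _
  rcases hfinal with h | h
  · exact (mul_ne_zero hlam hx0') h
  · rw [hv.map_mul _ _ hlam hx0', ← hM] at h
    linarith

lemma heckeMult_le {N : ℕ} (hN : 0 < N) {p : ℕ} (hp : 0 < p) (m : ℕ) (χ : DirichletCharacter ℂ N)
    {lam : ℂ} (hlam : lam ≠ 0) {v : ℂ → ℝ} (hv : IsPadicValuation p v) {n : ℕ} (hn : v lam < n) :
    heckeMult N p (m + 2 : ℤ) χ lam ≤ Nat.card (Qt N) * ((p + 1) * n) := by
  have : NeZero N := ⟨hN.ne'⟩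
  have hfin : Finite (Qt N) := inferInstance
  have : Fintype (Qt N) := Fintype.ofFinite _
  have hp' : 0 < (p : ℤ) := by exact_mod_cast hp
  have hle : Submodule.span ℂ {f : UpperHalfPlane → ℂ | IsCuspFormChi N (m + 2 : ℤ) χ f ∧
      heckeT N p (m + 2 : ℤ) χ f = fun z => lam * f z} ≤ eigenW N p m χ lam := by
    rw [Submodule.span_le]
    rintro f ⟨hf, hT⟩
    exact ⟨hf.good, hf.good.heckeEq hp hT⟩
  have hinj : Function.Injective ((perMap hN p m hp' χ lam n).comp (Submodule.inclusion hle)) :=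
    (perMap_inj hN hp' χ hlam hv hn).comp (Submodule.inclusion_injective hle)
  have h := LinearMap.finrank_le_finrank_of_injective hinj
  rw [Module.finrank_fintype_fun_eq_card] at h
  refine h.trans (le_of_eq ?_)
  simp [Fintype.card_prod, Nat.card_eq_fintype_card]

/-- **Calegari's bound.**  For `λ ≠ 0`, the multiplicity of `λ` as a `T_p`-eigenvalue on
`S_{k,χ}(N)` is `O(v_p(λ)²)`, uniformly in the weight `k` and the nebentypus `χ`: there
is a constant `C = C(p,N)` with `m_p(λ,k,χ,N) ≤ C·(1 + v_p(λ)²)` for all even `k > 0`,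
all `χ` and all `λ ≠ 0`. -/
theorem multiplicity_nonzero_eigenvalue_big_O_slope_sq
    (p N : ℕ) (hp : p.Prime) (hN : 0 < N) (hpN : ¬ p ∣ N)
    (v : ℂ → ℝ) (hv : IsPadicValuation p v) :
    ∃ C : ℝ, 0 < C ∧ ∀ (k : ℤ) (χ : DirichletCharacter ℂ N) (lam : ℂ),
      0 < k → Even k → lam ≠ 0 →
        (heckeMult N p k χ lam : ℝ) ≤ C * (1 + (v lam) ^ 2) := by
  have : NeZero N := ⟨hN.ne'⟩
  have hfin : Finite (Qt N) := inferInstance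
  have hcard : 0 < Nat.card (Qt N) := Nat.card_pos
  have hcardR : (0 : ℝ) < Nat.card (Qt N) := by exact_mod_cast hcard
  refine ⟨2 * Nat.card (Qt N) * (p + 1), by positivity, ?_⟩
  intro k χ lam hk hke hlam
  obtain ⟨m, rfl⟩ : ∃ m : ℕ, k = (m : ℤ) + 2 := by
    obtain ⟨r, hr⟩ := hke
    exact ⟨(k - 2).toNat, by omega⟩
  have h1 := heckeMult_le hN hp.pos m χ hlam hv (n := ⌊v lam⌋₊ + 1)
    (by push_cast; exact Nat.lt_floor_add_one _)
  have h2 : (heckeMult N p ((m : ℤ) + 2) χ lam : ℝ) ≤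
      Nat.card (Qt N) * ((p + 1) * ((⌊v lam⌋₊ : ℝ) + 1)) := by exact_mod_cast h1
  have h3 : (⌊v lam⌋₊ : ℝ) ≤ |v lam| :=
    (Nat.cast_le.mpr (Nat.floor_le_floor (le_abs_self _))).trans (Nat.floor_le (abs_nonneg _))
  have h4 : (⌊v lam⌋₊ : ℝ) + 1 ≤ 2 * (1 + v lam ^ 2) := by
    have := sq_nonneg (|v lam| - 1)
    have h5 := sq_abs (v lam)
    nlinarith
  refine h2.trans ?_
  calc (Nat.card (Qt N) : ℝ) * ((p + 1) * ((⌊v lam⌋₊ : ℝ) + 1))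
      ≤ Nat.card (Qt N) * ((p + 1) * (2 * (1 + v lam ^ 2))) := by gcongr
    _ = 2 * Nat.card (Qt N) * (p + 1) * (1 + v lam ^ 2) := by ring
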